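/- arXiv:2110.00102 — 2 statements merged into one kernel-verified Lean document; each statement's English description precedes it below -/
import Mathlib

section
/- Let 𝔽_q be a finite field of odd cardinality q. Let Δ ∈ 𝔽_q[T] be nonzero and let M ∈ 𝔽_q[T] be monic, squarefree and nonconstant with M ∣ Δ. For each monic irreducible divisor P of M let η_P denote the quadratic character of the finite field 𝔽_q[T]/(P), and for D coprime to M set χ(D) := ∏_{P ∣ M} η_P(D mod P). Then there exists a constant C (depending on q, Δ and M) such that for all N ≥ 1: | ∑_{D ∈ H_N(Δ)} χ(D) | ≤ C·q^{N/2}. -/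
open Polynomial UniqueFactorizationMonoid

section MonicPolynomials

variable {K : Type*} [Field K]

theorem eq_of_monic_irreducible_dvd {P Q : K[X]} (hP : P.Monic) (hQ : Q.Monic)
    (hP' : Irreducible P) (hQ' : Irreducible Q) (h : P ∣ Q) : P = Q :=
  eq_of_monic_of_associated hP hQ (hP'.associated_of_dvd hQ' h)

variable [Fintype K]

theorem finite_setOf_monic_natDegree_eq (n : ℕ) :
    {D : K[X] | D.Monic ∧ D.natDegree = n}.Finite := by
  refine (Set.finite_range fun c : Fin (n + 1) → K => ∑ i, C (c i) * X ^ (i : ℕ)).subset ?_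
  rintro D ⟨-, rfl⟩
  exact ⟨fun i => D.coeff i, by
    simpa only [Finset.sum_range] using D.as_sum_range_C_mul_X_pow.symm⟩

/-- The finset of monic polynomials of degree `n` over a finite field. -/
noncomputable def monicOfDegree (K : Type*) [Field K] [Fintype K] (n : ℕ) : Finset K[X] :=
  (finite_setOf_monic_natDegree_eq (K := K) n).toFinset

theorem mem_monicOfDegree {n : ℕ} {D : K[X]} :
    D ∈ monicOfDegree K n ↔ D.Monic ∧ D.natDegree = n := by
  simp [monicOfDegree]

theorem card_monicOfDegree_le (n : ℕ) :
    (monicOfDegree K n).card ≤ Fintype.card K ^ n := by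
  classical
  have h : (monicOfDegree K n).card ≤ (Finset.univ : Finset (Fin n → K)).card := by
    refine Finset.card_le_card_of_injOn (fun D i => D.coeff i) (by simp [Set.MapsTo]) ?_
    intro D hD E hE h
    rw [Finset.mem_coe, mem_monicOfDegree] at hD hE
    ext i
    rcases lt_trichotomy i n with hi | rfl | hi
    · exact congrFun h ⟨i, hi⟩
    · have h1 := hD.1.coeff_natDegree
      have h2 := hE.1.coeff_natDegree
      rw [hD.2] at h1
      rw [hE.2] at h2
      rw [h1, h2]
    · rw [coeff_eq_zero_of_natDegree_lt (hD.2 ▸ hi), coeff_eq_zero_of_natDegree_lt (hE.2 ▸ hi)]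
  simpa using h

theorem sum_monicOfDegree_eq_zero {Δ A : K[X]} (hΔ : Δ ≠ 0) (hA : IsCoprime A Δ)
    {f : K[X] → ℤ} (hf : ∀ D E, Δ ∣ D - E → f D = f E) (hfA : ∀ D, f (A * D) = -f D)
    {n : ℕ} (hn : Δ.natDegree ≤ n) :
    ∑ D ∈ monicOfDegree K n, f D = 0 := by
  classical
  let σ : K[X] → K[X] := fun D => D + ((A * D) % Δ - D % Δ)
  have hσ : ∀ D, Δ ∣ A * D - σ D := fun D =>
    ⟨(A * D) / Δ - D / Δ, by
      have h1 := EuclideanDomain.div_add_mod (A * D) Δ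
      have h2 := EuclideanDomain.div_add_mod D Δ
      linear_combination -h1 + h2⟩
  have hmaps : ∀ D ∈ monicOfDegree K n, σ D ∈ monicOfDegree K n := by
    intro D hD
    rw [mem_monicOfDegree] at hD ⊢
    have hdeg : ((A * D) % Δ - D % Δ).degree < D.degree := by
      refine ((degree_sub_le _ _).trans_lt (max_lt (EuclideanDomain.mod_lt _ hΔ)
        (EuclideanDomain.mod_lt _ hΔ))).trans_le ?_
      rw [degree_eq_natDegree hΔ, degree_eq_natDegree hD.1.ne_zero, hD.2]
      exact_mod_cast hn
    exact ⟨hD.1.add_of_left hdeg, (natDegree_add_eq_left_of_degree_lt hdeg).trans hD.2⟩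
  have hinj : Set.InjOn σ (monicOfDegree K n : Set K[X]) := by
    intro D _ E _ h
    have h1 : Δ ∣ A * (D - E) := by
      have h2 := dvd_sub (hσ D) (hσ E)
      rw [h] at h2
      convert h2 using 1
      ring
    have hmod : ∀ a b : K[X], Δ ∣ a - b → a % Δ = b % Δ := fun a b hab => by
      rw [← sub_eq_zero, ← sub_mod]
      exact EuclideanDomain.mod_eq_zero.2 hab
    have h3 := hmod _ _ (hA.symm.dvd_of_dvd_mul_left h1)
    have h4 := hmod (A * D) (A * E) (by rwa [← mul_sub])
    have h5 : D + ((A * D) % Δ - D % Δ) = E + ((A * E) % Δ - E % Δ) := h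
    rw [h3, h4] at h5
    exact add_right_cancel h5
  have key : ∑ D ∈ monicOfDegree K n, f D = ∑ D ∈ monicOfDegree K n, -f D := by
    symm
    refine Finset.sum_nbij σ hmaps hinj (Finset.surjOn_of_injOn_of_card_le σ hmaps hinj le_rfl) ?_
    intro D _
    rw [← hfA, hf _ _ (hσ D)]
  rw [Finset.sum_neg_distrib] at key
  linarith

theorem abs_sum_monicOfDegree_le {Δ A : K[X]} (hΔ : Δ ≠ 0) (hA : IsCoprime A Δ)
    {f : K[X] → ℤ} (hf : ∀ D E, Δ ∣ D - E → f D = f E) (hfA : ∀ D, f (A * D) = -f D)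
    (hf1 : ∀ D, |f D| ≤ 1) (n : ℕ) :
    |∑ D ∈ monicOfDegree K n, f D| ≤ Fintype.card K ^ Δ.natDegree := by
  rcases le_or_gt Δ.natDegree n with hn | hn
  · rw [sum_monicOfDegree_eq_zero hΔ hA hf hfA hn, abs_zero]
    positivity
  · calc |∑ D ∈ monicOfDegree K n, f D| ≤ ∑ D ∈ monicOfDegree K n, |f D| :=
          Finset.abs_sum_le_sum_abs _ _
      _ ≤ ∑ D ∈ monicOfDegree K n, 1 := Finset.sum_le_sum fun D _ => hf1 D
      _ = ((monicOfDegree K n).card : ℤ) := by simp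
      _ ≤ (Fintype.card K : ℤ) ^ n := by exact_mod_cast card_monicOfDegree_le n
      _ ≤ _ := pow_le_pow_right₀ (by exact_mod_cast Fintype.card_pos) hn.le

open Classical in
theorem abs_sum_monicOfDegree_sq_dvd_le {Δ A : K[X]} (hΔ : Δ ≠ 0) (hA : IsCoprime A Δ)
    {f : K[X] →* ℤ} (hf : ∀ D E, Δ ∣ D - E → f D = f E) (hfA : f A = -1)
    (hf1 : ∀ D, |f D| ≤ 1) (n : ℕ) {B : K[X]} (hB : B.Monic) :
    |∑ D ∈ monicOfDegree K n with B ^ 2 ∣ D, f D| ≤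
      if 2 * B.natDegree ≤ n then (Fintype.card K : ℤ) ^ Δ.natDegree else 0 := by
  have hB2 : (B ^ 2).natDegree = 2 * B.natDegree := hB.natDegree_pow 2
  split_ifs with hn
  · have : ∑ D ∈ monicOfDegree K n with B ^ 2 ∣ D, f D =
        ∑ E ∈ monicOfDegree K (n - 2 * B.natDegree), f (B ^ 2 * E) := by
      symm
      refine Finset.sum_nbij (B ^ 2 * ·) ?_ ?_ ?_ fun _ _ => rfl
      · intro E hE
        rw [mem_monicOfDegree] at hE
        rw [Finset.mem_filter, mem_monicOfDegree]
        refine ⟨⟨(hB.pow 2).mul hE.1, ?_⟩, dvd_mul_right _ _⟩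
        rw [(hB.pow 2).natDegree_mul hE.1, hB2, hE.2]
        omega
      · exact fun _ _ _ _ h => mul_left_cancel₀ (hB.pow 2).ne_zero h
      · intro D hD
        rw [Finset.mem_coe, Finset.mem_filter, mem_monicOfDegree] at hD
        obtain ⟨⟨hD1, hD2⟩, E, rfl⟩ := hD
        have hE := (hB.pow 2).of_mul_monic_left hD1
        refine ⟨E, ?_, rfl⟩
        rw [(hB.pow 2).natDegree_mul hE, hB2] at hD2
        rw [Finset.mem_coe, mem_monicOfDegree]
        exact ⟨hE, by omega⟩
    rw [this]
    simp only [map_mul, map_pow, ← Finset.mul_sum, abs_mul, abs_pow]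
    refine (mul_le_of_le_one_left (abs_nonneg _) (pow_le_one₀ (abs_nonneg _) (hf1 B))).trans ?_
    exact abs_sum_monicOfDegree_le hΔ hA hf (fun D => by rw [map_mul, hfA]; ring) hf1 _
  · rw [Finset.filter_false_of_mem, Finset.sum_empty, abs_zero]
    intro D hD hdvd
    rw [mem_monicOfDegree] at hD
    have := natDegree_le_of_dvd hdvd hD.1.ne_zero
    omega

/-- The finset of monic irreducible polynomials of degree at most `n` over a finite field. -/
noncomputable def monicIrreducibles (K : Type*) [Field K] [Fintype K] (n : ℕ) : Finset K[X] := by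
  classical
  exact ((Finset.range (n + 1)).biUnion (monicOfDegree K)).filter Irreducible

theorem mem_monicIrreducibles {n : ℕ} {P : K[X]} :
    P ∈ monicIrreducibles K n ↔ P.Monic ∧ P.natDegree ≤ n ∧ Irreducible P := by
  simp [monicIrreducibles, mem_monicOfDegree, and_assoc, and_left_comm]

open Classical in
theorem sum_powerset_sq_dvd_eq_ite_squarefree {D : K[X]} (hD : D ≠ 0) :
    ∑ U ∈ (monicIrreducibles K D.natDegree).powerset,
      (if (∏ P ∈ U, P) ^ 2 ∣ D then (-1 : ℤ) ^ U.card else 0) =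
      if Squarefree D then 1 else 0 := by
  have hS : ∀ P, P ∈ monicIrreducibles K D.natDegree ↔ _ := fun _ => mem_monicIrreducibles
  generalize monicIrreducibles K D.natDegree = S at hS ⊢
  set T := S.filter fun P => P ^ 2 ∣ D with hT
  have hfilter : S.powerset.filter (fun U => (∏ P ∈ U, P) ^ 2 ∣ D) = T.powerset := by
    ext U
    simp only [Finset.mem_filter, Finset.mem_powerset]
    constructor
    · rintro ⟨hU, hdvd⟩ P hP
      rw [hT, Finset.mem_filter]
      exact ⟨hU hP, (pow_dvd_pow_of_dvd (Finset.dvd_prod_of_mem (fun P => P) hP) 2).trans hdvd⟩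
    · intro hU
      refine ⟨hU.trans (Finset.filter_subset _ _), ?_⟩
      rw [← Finset.prod_pow]
      refine Finset.prod_dvd_of_coprime ?_ fun P hP => (Finset.mem_filter.1 (hU hP)).2
      intro P hP Q hQ hPQ
      have hP' := (hS _).1 (Finset.mem_filter.1 (hU hP)).1
      have hQ' := (hS _).1 (Finset.mem_filter.1 (hU hQ)).1
      exact IsCoprime.pow (hP'.2.2.coprime_iff_not_dvd.2 fun h =>
        hPQ (eq_of_monic_irreducible_dvd hP'.1 hQ'.1 hP'.2.2 hQ'.2.2 h))
  have hempty : T = ∅ ↔ Squarefree D := by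
    rw [squarefree_iff_no_irreducibles hD, Finset.eq_empty_iff_forall_notMem]
    constructor
    · intro h P hP hPD
      have hassoc := (normalize_associated P)
      have hdvd : normalize P ^ 2 ∣ D := by
        rw [← sq] at hPD
        exact ((hassoc.pow_pow).dvd).trans hPD
      refine h (normalize P) (Finset.mem_filter.2 ⟨(hS _).2
        ⟨monic_normalize hP.ne_zero, ?_, hassoc.symm.irreducible hP⟩, hdvd⟩)
      exact natDegree_le_of_dvd ((dvd_pow_self _ two_ne_zero).trans hdvd) hD
    · intro h P hP
      rw [hT, Finset.mem_filter, sq] at hP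
      exact h P ((hS _).1 hP.1).2.2 hP.2
  rw [← Finset.sum_filter, hfilter, Finset.sum_powerset_neg_one_pow_card]
  simp only [hempty]

open Classical in
theorem card_filter_powerset_monicIrreducibles_le (n : ℕ) :
    ((monicIrreducibles K n).powerset.filter
      fun U => 2 * (∏ P ∈ U, P).natDegree ≤ n).card ≤ Fintype.card K ^ (n / 2 + 1) := by
  have hmonic : ∀ U ⊆ monicIrreducibles K n, (∏ P ∈ U, P).Monic := fun U hU =>
    monic_prod_of_monic _ _ fun P hP => (mem_monicIrreducibles.1 (hU hP)).1
  calc _ ≤ ((Finset.range (n / 2 + 1)).biUnion (monicOfDegree K)).card := by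
        refine Finset.card_le_card_of_injOn (fun U => ∏ P ∈ U, P) ?_ ?_
        · intro U hU
          rw [Finset.mem_coe, Finset.mem_filter, Finset.mem_powerset] at hU
          simp only [Finset.coe_biUnion, Set.mem_iUnion, Finset.mem_coe, Finset.mem_range,
            mem_monicOfDegree]
          exact ⟨_, by omega, hmonic U hU.1, rfl⟩
        · intro U hU V hV h
          simp only [Finset.coe_filter, Finset.mem_powerset, Set.mem_ofPred_eq] at hU hV h
          have hmem : ∀ W ⊆ monicIrreducibles K n, ∀ P ∈ monicIrreducibles K n,
              (P ∈ W ↔ P ∣ ∏ Q ∈ W, Q) := by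
            intro W hW P hP
            refine ⟨fun hPW => Finset.dvd_prod_of_mem _ hPW, fun hdvd => ?_⟩
            have hP' := mem_monicIrreducibles.1 hP
            obtain ⟨Q, hQ, hPQ⟩ := (hP'.2.2.prime.dvd_finsetProd_iff _).1 hdvd
            have hQ' := mem_monicIrreducibles.1 (hW hQ)
            rwa [eq_of_monic_irreducible_dvd hP'.1 hQ'.1 hP'.2.2 hQ'.2.2 hPQ]
          ext P
          constructor
          · intro hP
            rw [hmem V hV.1 P (hU.1 hP), ← h]
            exact Finset.dvd_prod_of_mem _ hP
          · intro hP
            rw [hmem U hU.1 P (hV.1 hP), h]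
            exact Finset.dvd_prod_of_mem _ hP
    _ ≤ ∑ b ∈ Finset.range (n / 2 + 1), (monicOfDegree K b).card := Finset.card_biUnion_le
    _ ≤ ∑ b ∈ Finset.range (n / 2 + 1), Fintype.card K ^ b :=
        Finset.sum_le_sum fun b _ => card_monicOfDegree_le b
    _ ≤ _ := (Nat.geomSum_lt (Fintype.one_lt_card (α := K)) (by simp)).le

open Classical in
theorem abs_sum_squarefree_le {Δ A : K[X]} (hΔ : Δ ≠ 0) (hA : IsCoprime A Δ)
    {f : K[X] →* ℤ} (hf : ∀ D E, Δ ∣ D - E → f D = f E) (hfA : f A = -1)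
    (hf1 : ∀ D, |f D| ≤ 1) (n : ℕ) :
    |∑ D ∈ monicOfDegree K n with Squarefree D, f D| ≤
      (Fintype.card K : ℤ) ^ (Δ.natDegree + (n / 2 + 1)) := by
  have hexpand : ∑ D ∈ monicOfDegree K n with Squarefree D, f D =
      ∑ U ∈ (monicIrreducibles K n).powerset,
        (-1) ^ U.card * ∑ D ∈ monicOfDegree K n with (∏ P ∈ U, P) ^ 2 ∣ D, f D := by
    calc _ = ∑ D ∈ monicOfDegree K n, (if Squarefree D then 1 else 0) * f D := by
          simp [Finset.sum_filter]
      _ = ∑ D ∈ monicOfDegree K n, ∑ U ∈ (monicIrreducibles K n).powerset,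
            (if (∏ P ∈ U, P) ^ 2 ∣ D then (-1 : ℤ) ^ U.card else 0) * f D := by
          refine Finset.sum_congr rfl fun D hD => ?_
          rw [mem_monicOfDegree] at hD
          rw [← sum_powerset_sq_dvd_eq_ite_squarefree hD.1.ne_zero, Finset.sum_mul, hD.2]
      _ = _ := by
          rw [Finset.sum_comm]
          refine Finset.sum_congr rfl fun U _ => ?_
          rw [Finset.mul_sum, Finset.sum_filter]
          exact Finset.sum_congr rfl fun D _ => by split_ifs <;> simp
  rw [hexpand]
  calc _ ≤ ∑ U ∈ (monicIrreducibles K n).powerset,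
        (if 2 * (∏ P ∈ U, P).natDegree ≤ n then (Fintype.card K : ℤ) ^ Δ.natDegree else 0) := by
        refine (Finset.abs_sum_le_sum_abs _ _).trans (Finset.sum_le_sum fun U hU => ?_)
        rw [abs_mul, abs_pow, abs_neg, abs_one, one_pow, one_mul]
        refine abs_sum_monicOfDegree_sq_dvd_le hΔ hA hf hfA hf1 n ?_
        exact monic_prod_of_monic _ _ fun P hP =>
          (mem_monicIrreducibles.1 (Finset.mem_powerset.1 hU hP)).1
    _ = (((monicIrreducibles K n).powerset.filter
          fun U => 2 * (∏ P ∈ U, P).natDegree ≤ n).card : ℤ) *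
          (Fintype.card K : ℤ) ^ Δ.natDegree := by
        rw [← Finset.sum_filter, Finset.sum_const, nsmul_eq_mul]
    _ ≤ (Fintype.card K : ℤ) ^ (n / 2 + 1) * (Fintype.card K : ℤ) ^ Δ.natDegree := by
        gcongr
        exact_mod_cast card_filter_powerset_monicIrreducibles_le n
    _ = _ := by rw [← pow_add, add_comm]

end MonicPolynomials

section ResidueSymbol

variable {K : Type*} [Field K]

/-- The conditions characterizing `χ` as the quadratic residue symbol modulo `P`. -/
structure IsQuadraticSymbol (P : K[X]) (χ : K[X] → ℤ) : Prop where
  eq_zero_iff : ∀ D, χ D = 0 ↔ P ∣ D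
  eq_one_iff : ∀ D, χ D = 1 ↔ ¬P ∣ D ∧ ∃ E : K[X], P ∣ E ^ 2 - D
  eq_neg_one_iff : ∀ D, χ D = -1 ↔ ¬P ∣ D ∧ ¬∃ E : K[X], P ∣ E ^ 2 - D

namespace IsQuadraticSymbol

variable {P : K[X]} {χ : K[X] → ℤ}

theorem map_one (h : IsQuadraticSymbol P χ) (hP : Irreducible P) : χ 1 = 1 := by
  rw [h.eq_one_iff]
  exact ⟨fun h1 => hP.not_isUnit (isUnit_of_dvd_one h1), 1, by simp⟩

theorem abs_le_one (h : IsQuadraticSymbol P χ) (D : K[X]) : |χ D| ≤ 1 := by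
  by_cases h0 : P ∣ D
  · simp [(h.eq_zero_iff D).2 h0]
  by_cases h1 : ∃ E : K[X], P ∣ E ^ 2 - D
  · simp [(h.eq_one_iff D).2 ⟨h0, h1⟩]
  · simp [(h.eq_neg_one_iff D).2 ⟨h0, h1⟩]

variable [Fintype K]

open Classical in
theorem exists_quadraticChar [Fact (Irreducible P)] (h : IsQuadraticSymbol P χ) :
    ∃ _ : Fintype (AdjoinRoot P), ∀ D, χ D = quadraticChar (AdjoinRoot P) (AdjoinRoot.mk P D) := by
  have hP : P ≠ 0 := (Fact.out : Irreducible P).ne_zero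
  have : Module.Finite K (AdjoinRoot P) := (AdjoinRoot.powerBasis hP).finite
  have : Finite (AdjoinRoot P) := Module.finite_of_finite K
  refine ⟨Fintype.ofFinite _, fun D => ?_⟩
  rw [quadraticChar_apply, quadraticCharFun]
  have hsq : IsSquare (AdjoinRoot.mk P D) ↔ ∃ E : K[X], P ∣ E ^ 2 - D := by
    rw [isSquare_iff_exists_sq, AdjoinRoot.mk_surjective.exists]
    refine exists_congr fun E => ?_
    rw [eq_comm, ← map_pow, AdjoinRoot.mk_eq_mk]
  simp only [AdjoinRoot.mk_eq_zero, hsq]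
  split_ifs with h0 h1
  · exact (h.eq_zero_iff D).2 h0
  · exact (h.eq_one_iff D).2 ⟨h0, h1⟩
  · exact (h.eq_neg_one_iff D).2 ⟨h0, h1⟩

theorem map_mul (h : IsQuadraticSymbol P χ) (hP : Irreducible P) (D E : K[X]) :
    χ (D * E) = χ D * χ E := by
  classical
  have : Fact (Irreducible P) := ⟨hP⟩
  obtain ⟨_, hχ⟩ := h.exists_quadraticChar
  simp only [hχ, _root_.map_mul]

theorem congr (h : IsQuadraticSymbol P χ) (hP : Irreducible P) {D E : K[X]} (hDE : P ∣ D - E) :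
    χ D = χ E := by
  classical
  have : Fact (Irreducible P) := ⟨hP⟩
  obtain ⟨_, hχ⟩ := h.exists_quadraticChar
  rw [hχ, hχ, AdjoinRoot.mk_eq_mk.2 hDE]

theorem exists_eq_neg_one (h : IsQuadraticSymbol P χ) (hP : Irreducible P)
    (hq : Odd (Fintype.card K)) : ∃ D, χ D = -1 := by
  classical
  have : Fact (Irreducible P) := ⟨hP⟩
  obtain ⟨_, hχ⟩ := h.exists_quadraticChar
  have hchar : ringChar (AdjoinRoot P) ≠ 2 := by
    rw [← Algebra.ringChar_eq K (AdjoinRoot P)]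
    intro h2
    have := FiniteField.even_card_of_char_two h2
    rw [Nat.odd_iff] at hq
    omega
  obtain ⟨a, ha⟩ := quadraticChar_exists_neg_one hchar
  obtain ⟨D, rfl⟩ := AdjoinRoot.mk_surjective a
  exact ⟨D, (hχ D).trans ha⟩

end IsQuadraticSymbol

variable [Fintype K]

open Classical in
/-- The product over `P ∈ s` of the quadratic symbols `η P`, extended by zero to polynomials not
coprime to `Δ`. -/
noncomputable def quadraticSymbolProd (Δ : K[X]) (s : Finset K[X]) (η : K[X] → K[X] → ℤ)
    (hs : ∀ P ∈ s, Irreducible P) (hη : ∀ P ∈ s, IsQuadraticSymbol P (η P)) : K[X] →* ℤ where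
  toFun D := if IsCoprime D Δ then ∏ P ∈ s, η P D else 0
  map_one' := by
    rw [if_pos isCoprime_one_left]
    exact Finset.prod_eq_one fun P hP => (hη P hP).map_one (hs P hP)
  map_mul' D E := by
    have : ∏ P ∈ s, η P (D * E) = (∏ P ∈ s, η P D) * ∏ P ∈ s, η P E := by
      rw [← Finset.prod_mul_distrib]
      exact Finset.prod_congr rfl fun P hP => (hη P hP).map_mul (hs P hP) D E
    simp only [IsCoprime.mul_left_iff, this, ite_and]
    split_ifs <;> simp

variable {Δ : K[X]} {s : Finset K[X]} {η : K[X] → K[X] → ℤ}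
  {hs : ∀ P ∈ s, Irreducible P} {hη : ∀ P ∈ s, IsQuadraticSymbol P (η P)}

open Classical in
theorem quadraticSymbolProd_apply (D : K[X]) : quadraticSymbolProd Δ s η hs hη D =
    if IsCoprime D Δ then ∏ P ∈ s, η P D else 0 := rfl

theorem quadraticSymbolProd_congr (hsΔ : ∀ P ∈ s, P ∣ Δ) {D E : K[X]} (h : Δ ∣ D - E) :
    quadraticSymbolProd Δ s η hs hη D = quadraticSymbolProd Δ s η hs hη E := by
  classical
  have hcop : IsCoprime D Δ ↔ IsCoprime E Δ := by
    obtain ⟨c, hc⟩ := h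
    rw [sub_eq_iff_eq_add'.1 hc]
    exact IsCoprime.add_mul_left_left_iff
  have hprod : ∏ P ∈ s, η P D = ∏ P ∈ s, η P E :=
    Finset.prod_congr rfl fun P hP => (hη P hP).congr (hs P hP) ((hsΔ P hP).trans h)
  rw [quadraticSymbolProd_apply, quadraticSymbolProd_apply, hprod]
  exact if_congr hcop rfl rfl

theorem abs_quadraticSymbolProd_le_one (D : K[X]) :
    |quadraticSymbolProd Δ s η hs hη D| ≤ 1 := by
  rw [quadraticSymbolProd_apply]
  split_ifs
  · rw [Finset.abs_prod]
    exact Finset.prod_le_one (fun _ _ => abs_nonneg _) fun P hP => (hη P hP).abs_le_one D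
  · simp

theorem exists_quadraticSymbolProd_eq_neg_one (hq : Odd (Fintype.card K)) (hΔ : Δ ≠ 0)
    (hsΔ : ∀ P ∈ s, P ∣ Δ) (hmonic : ∀ P ∈ s, P.Monic) (hne : s.Nonempty) :
    ∃ A, IsCoprime A Δ ∧ quadraticSymbolProd Δ s η hs hη A = -1 := by
  classical
  obtain ⟨P, hP⟩ := hne
  obtain ⟨a, ha⟩ := (hη P hP).exists_eq_neg_one (hs P hP) hq
  obtain ⟨Δ', hfac, hndvd⟩ :=
    (FiniteMultiplicity.of_not_isUnit (hs P hP).not_isUnit hΔ).exists_eq_pow_mul_and_not_dvd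
  obtain ⟨u, v, huv⟩ := (hs P hP).coprime_iff_not_dvd.2 hndvd
  set A := 1 + Δ' * (v * (a - 1)) with hA
  have hAa : P ∣ A - a := ⟨-(a - 1) * u, by rw [hA]; linear_combination (a - 1) * huv⟩
  have hηA : η P A = -1 := ((hη P hP).congr (hs P hP) hAa).trans ha
  have hcop : IsCoprime A Δ := by
    rw [hfac]
    refine IsCoprime.mul_right (IsCoprime.pow_right ?_) ?_
    · exact ((hs P hP).coprime_iff_not_dvd.2 (((hη P hP).eq_neg_one_iff A).1 hηA).1).symm
    · exact IsCoprime.add_mul_left_left_iff.2 isCoprime_one_left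
  refine ⟨A, hcop, ?_⟩
  rw [quadraticSymbolProd_apply, if_pos hcop, Finset.prod_eq_single_of_mem P hP, hηA]
  intro Q hQ hQP
  have hQΔ' : Q ∣ Δ' := by
    refine ((hs Q hQ).prime.dvd_or_dvd (hfac ▸ hsΔ Q hQ)).resolve_left fun h => hQP ?_
    exact eq_of_monic_irreducible_dvd (hmonic Q hQ) (hmonic P hP) (hs Q hQ) (hs P hP)
      ((hs Q hQ).prime.dvd_of_dvd_pow h)
  rw [(hη Q hQ).congr (hs Q hQ) (E := 1) (hQΔ'.trans ⟨v * (a - 1), by rw [hA]; ring⟩),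
    (hη Q hQ).map_one (hs Q hQ)]

end ResidueSymbol

/-- The key estimate in the proof of Lemma 3.4 of the paper: square-root cancellation for the
sum of the quadratic character `χ(D) = ∏_{P ∣ M} η_P(D mod P)` over the family `H_N(Δ)` of
monic squarefree polynomials of degree `N` coprime to `Δ`:
`|∑_{D ∈ H_N(Δ)} χ(D)| ≤ C·q^{N/2}`.
Here `η P D` is the quadratic character of the residue field `𝔽_q[T]/(P)` evaluated at
`D mod P`. -/
theorem quadratic_character_sum_over_squarefree_bound
    (Fq : Type*) [Field Fq] [Fintype Fq] [DecidableEq Fq]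
    (hq : Odd (Fintype.card Fq))
    (Δ M : Fq[X]) (hΔ : Δ ≠ 0) (hMmonic : M.Monic) (hMsf : Squarefree M)
    (hMnc : 0 < M.natDegree) (hMΔ : M ∣ Δ)
    (η : Fq[X] → Fq[X] → ℤ)
    (hη0 : ∀ P D : Fq[X], Irreducible P → P ∣ M → (η P D = 0 ↔ P ∣ D))
    (hη1 : ∀ P D : Fq[X], Irreducible P → P ∣ M →
      (η P D = 1 ↔ ¬P ∣ D ∧ ∃ E : Fq[X], P ∣ E ^ 2 - D))
    (hη2 : ∀ P D : Fq[X], Irreducible P → P ∣ M →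
      (η P D = -1 ↔ ¬P ∣ D ∧ ¬∃ E : Fq[X], P ∣ E ^ 2 - D)) :
    ∃ C : ℝ, ∀ N : ℕ, 1 ≤ N →
      |∑ᶠ D ∈ {D : Fq[X] | D.Monic ∧ Squarefree D ∧ D.natDegree = N ∧ IsCoprime D Δ},
          ((∏ P ∈ (normalizedFactors M).toFinset, η P D : ℤ) : ℝ)| ≤
        C * Real.sqrt (Fintype.card Fq) ^ N := by
  classical
  set s := (normalizedFactors M).toFinset with hs_def
  have hM0 : M ≠ 0 := hMmonic.ne_zero
  have hmem : ∀ P ∈ s, P ∈ normalizedFactors M := fun P hP => Multiset.mem_toFinset.1 hP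
  have hs : ∀ P ∈ s, Irreducible P := fun P hP => irreducible_of_normalized_factor P (hmem P hP)
  have hsM : ∀ P ∈ s, P ∣ M := fun P hP => dvd_of_mem_normalizedFactors (hmem P hP)
  have hsΔ : ∀ P ∈ s, P ∣ Δ := fun P hP => (hsM P hP).trans hMΔ
  have hmonic : ∀ P ∈ s, P.Monic := fun P hP => by
    rw [← normalize_normalized_factor P (hmem P hP)]
    exact monic_normalize (hs P hP).ne_zero
  have hne : s.Nonempty := by
    obtain ⟨P, hP⟩ := exists_mem_normalizedFactors hM0 fun h =>
      hMnc.ne' (natDegree_eq_zero_of_isUnit h)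
    exact ⟨P, Multiset.mem_toFinset.2 hP⟩
  have hη : ∀ P ∈ s, IsQuadraticSymbol P (η P) := fun P hP =>
    ⟨fun D => hη0 P D (hs P hP) (hsM P hP), fun D => hη1 P D (hs P hP) (hsM P hP),
      fun D => hη2 P D (hs P hP) (hsM P hP)⟩
  obtain ⟨A, hA, hfA⟩ := exists_quadraticSymbolProd_eq_neg_one (hs := hs) (hη := hη)
    hq hΔ hsΔ hmonic hne
  refine ⟨(Fintype.card Fq : ℝ) ^ (Δ.natDegree + 1), fun N _ => ?_⟩
  have hbound := abs_sum_squarefree_le hΔ hA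
    (fun D E => quadraticSymbolProd_congr hsΔ) hfA abs_quadraticSymbolProd_le_one N
  have hsum : ∑ᶠ D ∈ {D : Fq[X] | D.Monic ∧ Squarefree D ∧ D.natDegree = N ∧ IsCoprime D Δ},
      ((∏ P ∈ s, η P D : ℤ) : ℝ) =
      ((∑ D ∈ monicOfDegree Fq N with Squarefree D,
        quadraticSymbolProd Δ s η hs hη D : ℤ) : ℝ) := by
    have hset : {D : Fq[X] | D.Monic ∧ Squarefree D ∧ D.natDegree = N ∧ IsCoprime D Δ} =
        (((monicOfDegree Fq N).filter Squarefree).filter (IsCoprime · Δ) : Finset Fq[X]) := by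
      ext D
      simp only [Set.mem_ofPred_eq, Finset.mem_coe, Finset.mem_filter, mem_monicOfDegree]
      tauto
    rw [hset, finsum_mem_coe_finset]
    simp only [quadraticSymbolProd_apply]
    rw [← Finset.sum_filter, Int.cast_sum]
  rw [hsum]
  have hq1 : (1 : ℝ) ≤ Real.sqrt (Fintype.card Fq) :=
    Real.one_le_sqrt.2 (by exact_mod_cast Fintype.card_pos)
  calc _ ≤ (Fintype.card Fq : ℝ) ^ (Δ.natDegree + (N / 2 + 1)) := by
        exact_mod_cast hbound
    _ = (Fintype.card Fq : ℝ) ^ (Δ.natDegree + 1) *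
          Real.sqrt (Fintype.card Fq) ^ (2 * (N / 2)) := by
        rw [pow_mul, Real.sq_sqrt (Nat.cast_nonneg _), ← pow_add]
        congr 1
        omega
    _ ≤ _ := by
        gcongr
        omega
end

section
/- Let 𝔽_q be a finite field with q ≡ 1 (mod 6) and let B ∈ 𝔽_q[T] be nonzero. For every ε > 0 there exists a constant C (depending on q, B and ε) such that for every monic irreducible P ∈ 𝔽_q[T], every multiplicative character ψ of the finite field 𝔽_q[T]/(P) with ψ³ trivial and ψ nontrivial (extended by ψ(0) = 0), and every N ≥ 1: | ∑_{D ∈ F_N(B)} ψ(D mod P) | ≤ C · e^{2·deg(P)} · q^{(1/2 + ε)N}. -/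
open Polynomial UniqueFactorizationMonoid

/-- `D` is cube-free: no monic irreducible polynomial `P` satisfies `P³ ∣ D`. -/
def Polynomial.CubeFree {Fq : Type*} [Field Fq] (D : Fq[X]) : Prop :=
  ∀ P : Fq[X], P.Monic → Irreducible P → ¬P ^ 3 ∣ D

/-- `deg(rad D)`: the sum of the degrees of the distinct monic irreducible divisors of `D`. -/
noncomputable def Polynomial.radDeg {Fq : Type*} [Field Fq] [DecidableEq Fq] (D : Fq[X]) : ℕ :=
  ∑ P ∈ (normalizedFactors D).toFinset, P.natDegree

/-- The family `F_N(B)`: monic cube-free polynomials coprime to `B` with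
`deg(rad D) = N` and `3 ∣ deg D`. -/
def cubicTwistFamily {Fq : Type*} [Field Fq] [DecidableEq Fq] (B : Fq[X]) (N : ℕ) :
    Set (Fq[X]) :=
  {D | D.Monic ∧ D.CubeFree ∧ IsCoprime D B ∧ D.radDeg = N ∧ 3 ∣ D.natDegree}

theorem exists_mul_hasseDeriv_pow {K : Type*} [Field K] (f : K[X]) (e : ℕ) :
    ∃ c : ℕ → K[X], ∀ l, (c l).natDegree ≤ l * f.natDegree ∧
      f ^ l * hasseDeriv l (f ^ e) = f ^ e * c l := by
  induction e with
  | zero =>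
    refine ⟨fun l => if l = 0 then 1 else 0, fun l => ?_⟩
    rcases Nat.eq_zero_or_pos l with rfl | hl
    · simp
    · simp [hl.ne', hasseDeriv_apply_one _ hl]
  | succ e ih =>
    obtain ⟨c, hc⟩ := ih
    refine ⟨fun l => ∑ ij ∈ Finset.HasAntidiagonal.antidiagonal l,
      c ij.1 * (if ij.2 = 0 then 1 else f ^ (ij.2 - 1) * hasseDeriv ij.2 f), fun l => ⟨?_, ?_⟩⟩
    · refine natDegree_sum_le_of_forall_le _ _ fun ij hij => ?_
      have h1 := (hc ij.1).1
      rw [← Finset.HasAntidiagonal.mem_antidiagonal.1 hij, add_mul]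
      refine natDegree_mul_le.trans (add_le_add h1 ?_)
      split_ifs with h
      · simp
      · refine natDegree_mul_le.trans ?_
        have h2 := natDegree_pow_le (p := f) (n := ij.2 - 1)
        have h3 := natDegree_hasseDeriv_le f ij.2
        obtain ⟨k, hk⟩ := Nat.exists_eq_succ_of_ne_zero h
        rw [hk] at h2 h3 ⊢
        simp only [Nat.succ_eq_add_one, Nat.add_sub_cancel] at *
        rw [add_mul]
        omega
    · rw [pow_succ f e, hasseDeriv_mul, Finset.mul_sum, Finset.mul_sum]
      refine Finset.sum_congr rfl fun ij hij => ?_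
      have h1 := (hc ij.1).2
      rw [← Finset.HasAntidiagonal.mem_antidiagonal.1 hij]
      split_ifs with h
      · rw [h]
        simp only [add_zero, hasseDeriv_zero', mul_one]
        linear_combination f * h1
      · obtain ⟨k, hk⟩ := Nat.exists_eq_succ_of_ne_zero h
        rw [hk]
        simp only [Nat.succ_eq_add_one, Nat.add_sub_cancel]
        linear_combination f ^ (k + 1) * hasseDeriv (k + 1) f * h1

/-- The polynomial `b` with `f ^ l * hasseDeriv l (a * f ^ e) = f ^ e * b`, linear in `a`. -/
theorem exists_linearMap_hasseDeriv_mul_pow {K : Type*} [Field K] (f : K[X]) (e l : ℕ) :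
    ∃ b : K[X] →ₗ[K] K[X], ∀ a, (b a).natDegree ≤ a.natDegree + l * f.natDegree ∧
      f ^ l * hasseDeriv l (a * f ^ e) = f ^ e * b a := by
  obtain ⟨c, hc⟩ := exists_mul_hasseDeriv_pow f e
  refine ⟨∑ ij ∈ Finset.HasAntidiagonal.antidiagonal l,
    (LinearMap.mulRight K (c ij.2) ∘ₗ LinearMap.mulRight K (f ^ ij.1)) ∘ₗ hasseDeriv ij.1,
    fun a => ⟨?_, ?_⟩⟩
  · simp only [LinearMap.sum_apply, LinearMap.comp_apply, LinearMap.mulRight_apply]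
    refine natDegree_sum_le_of_forall_le _ _ fun ij hij => ?_
    have h1 := (hc ij.2).1
    have h2 := natDegree_pow_le (p := f) (n := ij.1)
    have h3 := natDegree_hasseDeriv_le a ij.1
    rw [← Finset.HasAntidiagonal.mem_antidiagonal.1 hij, add_mul]
    refine natDegree_mul_le.trans ?_
    have h4 := natDegree_mul_le (p := hasseDeriv ij.1 a) (q := f ^ ij.1)
    omega
  · simp only [LinearMap.sum_apply, LinearMap.comp_apply, LinearMap.mulRight_apply]
    rw [hasseDeriv_mul, Finset.mul_sum, Finset.mul_sum]
    refine Finset.sum_congr rfl fun ij hij => ?_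
    rw [← Finset.HasAntidiagonal.mem_antidiagonal.1 hij]
    linear_combination f ^ ij.1 * hasseDeriv ij.1 a * (hc ij.2).2

theorem X_sub_C_pow_dvd_of_hasseDeriv {K : Type*} [Field K] (F : K[X]) (x : K) (M : ℕ)
    (h : ∀ l < M, (hasseDeriv l F).eval x = 0) : (X - C x) ^ M ∣ F := by
  have h1 : X ^ M ∣ taylor x F := by
    rw [X_pow_dvd_iff]
    intro l hl
    rw [taylor_coeff, h l hl]
  have h2 := map_dvd (taylorAlgHom (-x)) h1
  simpa [taylor_taylor, sub_eq_add_neg] using h2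

theorem sum_mul_pow_ne_zero {K : Type*} [Field K] (h : K[X]) (θ : K) (hθ : h.eval θ ≠ 0)
    {A n : ℕ} (w e : ℕ → ℕ) (hw : ∀ i j, i < j → w i + A ≤ w j) (a : Fin n → K[X])
    (ha : ∀ v, (a v).degree < A) (hne : a ≠ 0) :
    ∑ v, a v * h ^ e v * (X - C θ) ^ w v ≠ 0 := by
  classical
  intro h0
  have hS : (Finset.univ.filter fun v => a v ≠ 0).Nonempty := by
    by_contra hc
    apply hne
    funext v
    by_contra hv
    exact hc ⟨v, by simpa using hv⟩
  obtain ⟨v, hv, hmin⟩ := Finset.exists_min_image _ (fun v : Fin n => v) hS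
  have hv' : a v ≠ 0 := by simpa using hv
  have hdvd : (X - C θ) ^ (w v + A) ∣ a v * h ^ e v * (X - C θ) ^ w v := by
    rw [← Finset.add_sum_erase _ _ (Finset.mem_univ v), ] at h0
    rw [eq_neg_of_add_eq_zero_left h0, dvd_neg]
    refine Finset.dvd_sum fun u hu => ?_
    by_cases hau : a u = 0
    · simp [hau]
    · have := hmin u (by simpa using hau)
      have hlt : v < u := lt_of_le_of_ne this (Finset.ne_of_mem_erase hu).symm
      exact Dvd.dvd.mul_left (pow_dvd_pow _ (hw _ _ hlt)) _
  rw [pow_add, mul_comm] at hdvd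
  have hd2 := (mul_dvd_mul_iff_right (pow_ne_zero _ (X_sub_C_ne_zero θ))).1 hdvd
  have hcop : IsCoprime ((X - C θ) ^ A) (h ^ e v) := by
    refine IsCoprime.pow ?_
    rw [(irreducible_X_sub_C θ).coprime_iff_not_dvd, dvd_iff_isRoot]
    exact hθ
  have hd3 := hcop.dvd_of_dvd_mul_right hd2
  have := degree_le_of_dvd hd3 hv'
  rw [degree_pow, degree_X_sub_C, nsmul_one] at this
  exact absurd (ha v) (not_lt.2 this)

theorem stepanov_dimension_count {q s A d J : ℕ} (hs : q = s ^ 2) (hA : q = 3 * A + 1) (h3 : 3 ≤ s)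
    (hJ : J = s / 3 + 2 * d + 3) : s * (A + s * d + J) < 3 * J * A := by
  have h1 : s + 6 * d + 7 ≤ 3 * J := by omega
  have h2 : 2 * s + 2 ≤ q := by nlinarith
  obtain ⟨t, ht⟩ : ∃ t, q = s + 1 + t := ⟨q - (s + 1), by omega⟩
  have h4 : q ≤ 2 * t := by omega
  have h5 : (s + 6 * d + 7) * t ≤ 3 * J * t := Nat.mul_le_mul_right _ h1
  have h6 : 3 * A = s + t := by omega
  have h7 : 3 * (s * A) = s * (s + t) := by rw [← h6]; ring
  have h8 : 3 * J * A = J * (s + t) := by rw [← h6]; ring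
  have h9 : s * s = q := by rw [hs]; ring
  have h10 : 3 * (s * (s * d)) = 3 * (q * d) := by rw [← h9]; ring
  have h11 : q * d ≤ 2 * t * d := Nat.mul_le_mul_right _ h4
  nlinarith

theorem exists_stepanov_coefficients {K : Type*} [Field K] (f : K[X]) (c θ : K) {s A J : ℕ}
    (hcount : s * (A + s * f.natDegree + J) < 3 * J * A) :
    ∃ a : Fin (3 * J) → K[X], a ≠ 0 ∧ (∀ v, (a v).degree < A) ∧
      ∀ x, f.eval x ^ A = c → f.eval x ≠ 0 → ∀ l < s,
        (hasseDeriv l (∑ v : Fin (3 * J), C ((x - θ) ^ (v / 3 : ℕ)) *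
          (a v * f ^ (A * (v % 3 : ℕ))))).eval x = 0 := by
  classical
  choose b hb using fun e l => exists_linearMap_hasseDeriv_mul_pow f e l
  let g (l : ℕ) : (Fin (3 * J) → K[X]) →ₗ[K] K[X] :=
    ∑ v : Fin (3 * J), LinearMap.mulLeft K (C (c ^ (v % 3 : ℕ)) * (X - C θ) ^ (v / 3 : ℕ)) ∘ₗ
      b (A * (v % 3 : ℕ)) l ∘ₗ LinearMap.proj v
  let ι : (Fin (3 * J) → degreeLT K A) →ₗ[K] (Fin (3 * J) → K[X]) :=
    LinearMap.pi fun v => (degreeLT K A).subtype ∘ₗ LinearMap.proj v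
  have hg (l : ℕ) (hl : l < s) (a) : g l (ι a) ∈ degreeLT K (A + s * f.natDegree + J) := by
    simp only [g, ι, LinearMap.sum_apply, LinearMap.comp_apply, LinearMap.proj_apply,
      LinearMap.mulLeft_apply, LinearMap.pi_apply, Submodule.subtype_apply]
    refine Submodule.sum_mem _ fun v _ => ?_
    by_cases ha0 : (a v : K[X]) = 0
    · simp [ha0]
    rw [mem_degreeLT]
    refine degree_le_natDegree.trans_lt ?_
    rw [Nat.cast_lt]
    refine natDegree_mul_le.trans_lt ?_
    have h1 := (hb (A * (v % 3 : ℕ)) l (a v)).1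
    have h2 : (C (c ^ (v % 3 : ℕ)) * (X - C θ) ^ (v / 3 : ℕ)).natDegree ≤ (v / 3 : ℕ) := by
      refine (natDegree_C_mul_le _ _).trans ?_
      refine natDegree_pow_le.trans ?_
      simp
    have h3 : (a v : K[X]).natDegree < A :=
      (natDegree_lt_iff_degree_lt ha0).2 (mem_degreeLT.1 (a v).2)
    have h4 : l * f.natDegree ≤ s * f.natDegree := Nat.mul_le_mul_right _ hl.le
    have h5 := v.2
    omega
  let Φ : (Fin (3 * J) → degreeLT K A) →ₗ[K] (Fin s → degreeLT K (A + s * f.natDegree + J)) :=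
    LinearMap.pi fun l => LinearMap.codRestrict _ (g l ∘ₗ ι) (hg l l.2)
  have hker : LinearMap.ker Φ ≠ ⊥ := by
    have : Module.Finite K (degreeLT K A) := Module.Finite.equiv (degreeLTEquiv K A).symm
    have : Module.Finite K (degreeLT K (A + s * f.natDegree + J)) :=
      Module.Finite.equiv (degreeLTEquiv K _).symm
    apply LinearMap.ker_ne_bot_of_finrank_lt
    rw [Module.finrank_pi_fintype, Module.finrank_pi_fintype]
    simp only [(degreeLTEquiv K _).finrank_eq, Module.finrank_fin_fun, Finset.sum_const,
      Finset.card_univ, Fintype.card_fin, smul_eq_mul]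
    exact hcount
  obtain ⟨a, ha, hane⟩ := Submodule.exists_mem_ne_zero_of_ne_bot hker
  refine ⟨ι a, ?_, fun v => mem_degreeLT.1 (a v).2, ?_⟩
  · intro h0
    apply hane
    funext v
    exact Subtype.ext (congrFun h0 v)
  · intro x hx hx0 l hl
    have h1 : g l (ι a) = 0 := by
      have := congrFun (LinearMap.mem_ker.1 ha) ⟨l, hl⟩
      exact congrArg Subtype.val this
    have h2 := congrArg (eval x) h1
    simp only [g, LinearMap.sum_apply, LinearMap.comp_apply, LinearMap.proj_apply,
      LinearMap.mulLeft_apply, eval_finsetSum, eval_zero] at h2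
    rw [map_sum, eval_finsetSum]
    have h3 : f.eval x ^ l ≠ 0 := pow_ne_zero _ hx0
    apply (mul_eq_zero_iff_left h3).1
    rw [← h2, Finset.mul_sum]
    refine Finset.sum_congr rfl fun v _ => ?_
    have h4 := congrArg (eval x) (hb (A * (v % 3 : ℕ)) l (ι a v)).2
    rw [← smul_eq_C_mul, map_smul]
    simp only [eval_mul, eval_pow, eval_smul, eval_C, eval_sub, eval_X, smul_eq_mul] at h4 ⊢
    rw [pow_mul (f.eval x), hx] at h4
    linear_combination (x - θ) ^ (v / 3 : ℕ) * h4

theorem card_eval_pow_eq_le {K : Type*} [Field K] [Fintype K] [DecidableEq K] (f h : K[X]) (θ c : K)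
    (hf : f = (X - C θ) * h) (hθ : h.eval θ ≠ 0) {q s A : ℕ} (hq : Fintype.card K = q)
    (hs : q = s ^ 2) (hA : q = 3 * A + 1) (h3 : 3 ≤ s) (hc : c ≠ 0) :
    (Finset.univ.filter fun x => f.eval x ^ A = c).card * s ≤
      A + 2 * f.natDegree * A + (s / 3 + 2 * f.natDegree + 2) * q := by
  classical
  set d := f.natDegree
  obtain ⟨J, hJ⟩ : ∃ J, J = s / 3 + 2 * d + 3 := ⟨_, rfl⟩
  obtain ⟨a, hane, hadeg, hvan⟩ := exists_stepanov_coefficients f c θ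
    (stepanov_dimension_count hs hA h3 hJ)
  have hA0 : 0 < A := by nlinarith
  set R : K[X] := ∑ v : Fin (3 * J), (X - C θ) ^ (q * (v / 3 : ℕ)) *
    (a v * f ^ (A * (v % 3 : ℕ))) with hR
  have hR0 : R ≠ 0 := by
    have := sum_mul_pow_ne_zero h θ hθ (A := A) (fun v => q * (v / 3) + A * (v % 3))
      (fun v => A * (v % 3)) ?_ a hadeg hane
    · convert this using 1
      refine Finset.sum_congr rfl fun v _ => ?_
      rw [hf, mul_pow, pow_add]
      ring
    · intro i j hij
      have hi := Nat.div_add_mod i 3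
      have hj := Nat.div_add_mod j 3
      subst hA
      have hij2 : i / 3 ≤ j / 3 := Nat.div_le_div_right hij.le
      generalize i / 3 = i1 at *
      generalize i % 3 = i2 at *
      generalize j / 3 = j1 at *
      generalize j % 3 = j2 at *
      have : A * (3 * i1 + i2 + 1) ≤ A * (3 * j1 + j2) := Nat.mul_le_mul_left _ (by omega)
      nlinarith
  have hdvd : ∀ x ∈ Finset.univ.filter (fun x => f.eval x ^ A = c), (X - C x) ^ s ∣ R := by
    intro x hx
    have hx : f.eval x ^ A = c := by simpa using hx
    have hx0 : f.eval x ≠ 0 := by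
      intro h0
      rw [h0, zero_pow hA0.ne'] at hx
      exact hc hx.symm
    have h1 := X_sub_C_pow_dvd_of_hasseDeriv _ x s (hvan x hx hx0)
    have h2 : (X - C x) ^ s ∣ R - ∑ v : Fin (3 * J), C ((x - θ) ^ (v / 3 : ℕ)) *
          (a v * f ^ (A * (v % 3 : ℕ))) := by
      rw [hR, ← Finset.sum_sub_distrib]
      refine Finset.dvd_sum fun v _ => ?_
      rw [← sub_mul]
      refine Dvd.dvd.mul_right ?_ _
      rw [pow_mul, C_pow]
      refine dvd_trans ?_ (sub_dvd_pow_sub_pow _ _ _)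
      have h3 : (X - C θ) ^ q - C (x - θ) = (X - C x) ^ q := by
        obtain ⟨p, hp⟩ := CharP.exists K
        have hpp : Fact p.Prime := ⟨CharP.char_is_prime K p⟩
        obtain ⟨n, -, hn⟩ := FiniteField.card K p
        have hKq (y : K) : y ^ p ^ (n : ℕ) = y := by rw [← hn]; exact FiniteField.pow_card y
        rw [← hq, hn, sub_pow_char_pow, sub_pow_char_pow, ← C_pow, ← C_pow, hKq, hKq, C_sub]
        ring
      rw [h3]
      exact pow_dvd_pow _ (by nlinarith)
    exact (dvd_iff_dvd_of_dvd_sub h2).2 h1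
  have hprod : (∏ x ∈ Finset.univ.filter (fun x => f.eval x ^ A = c), (X - C x) ^ s) ∣ R := by
    refine Finset.prod_dvd_of_coprime ?_ hdvd
    intro x _ y _ hxy
    exact (isCoprime_X_sub_C_of_isUnit_sub (sub_ne_zero.2 hxy).isUnit).pow
  have hdeg := natDegree_le_of_dvd hprod hR0
  rw [natDegree_prod _ _ fun x _ => pow_ne_zero _ (X_sub_C_ne_zero x)] at hdeg
  simp only [natDegree_pow, natDegree_X_sub_C, mul_one, Finset.sum_const, smul_eq_mul] at hdeg
  refine hdeg.trans ?_
  refine natDegree_sum_le_of_forall_le _ _ fun v _ => ?_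
  refine natDegree_mul_le.trans ?_
  have h1 : ((X - C θ) ^ (q * (v / 3 : ℕ))).natDegree ≤ q * (s / 3 + 2 * d + 2) := by
    simp only [natDegree_pow, natDegree_X_sub_C, mul_one]
    refine Nat.mul_le_mul_left _ ?_
    have := v.2
    omega
  have h2 : (a v).natDegree ≤ A := natDegree_le_of_degree_le (hadeg v).le
  have h3 : (f ^ (A * (v % 3 : ℕ))).natDegree ≤ A * 2 * d := by
    refine natDegree_pow_le.trans (Nat.mul_le_mul_right _ (Nat.mul_le_mul_left _ ?_))
    omega
  have h4 := natDegree_mul_le (p := a v) (q := f ^ (A * (v % 3 : ℕ)))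
  calc _ ≤ q * (s / 3 + 2 * d + 2) + (A + A * 2 * d) := by omega
    _ = _ := by ring

theorem exists_pow_near_one {ι : Type*} [Fintype ι] (u : ι → ℂ) (hu : ∀ i, ‖u i‖ = 1) (N : ℕ) :
    ∃ n, N ≤ n ∧ ∀ i, ‖u i ^ n - 1‖ < 1 / 2 := by
  have hb : ∀ n : ℕ, u ^ n ∈ Metric.closedBall (0 : ι → ℂ) 1 := by
    intro n
    rw [mem_closedBall_zero_iff, pi_norm_le_iff_of_nonneg zero_le_one]
    intro i
    simp [hu]
  obtain ⟨a, -, φ, hφ, hlim⟩ := (isCompact_closedBall (0 : ι → ℂ) 1).tendsto_subseq hb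
  have hc := hlim.cauchySeq
  obtain ⟨M, hM⟩ := Metric.cauchySeq_iff'.1 hc (1 / 2) (by norm_num)
  have h1 : M ≤ φ M + N + M := by omega
  have h2 : φ M + N + M ≤ φ (φ M + N + M) := hφ.id_le _
  refine ⟨φ (φ M + N + M) - φ M, by omega, fun i => ?_⟩
  have h3 := (dist_pi_lt_iff (by norm_num)).1 (hM _ h1) i
  simp only [Function.comp_apply, Pi.pow_apply, dist_eq_norm] at h3
  have h4 : u i ^ φ (φ M + N + M) - u i ^ φ M =
      u i ^ φ M * (u i ^ (φ (φ M + N + M) - φ M) - 1) := by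
    rw [mul_sub, ← pow_add, mul_one]
    congr 2
    omega
  rw [h4, norm_mul, norm_pow, hu, one_pow, one_mul] at h3
  exact h3

theorem norm_le_of_norm_sum_pow_le {ι : Type*} [Fintype ι] (α : ι → ℂ) {C R : ℝ} {D N : ℕ}
    (hR : 0 < R) (hD : D ≠ 0) (h : ∀ n, N ≤ n → ‖∑ i, α i ^ (D * n)‖ ≤ C * R ^ (D * n)) (i : ι) :
    ‖α i‖ ≤ R := by
  classical
  obtain ⟨i₀, -, hmax⟩ := Finset.exists_max_image Finset.univ
    (fun i => ‖α i‖) ⟨i, Finset.mem_univ i⟩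
  refine (hmax i (Finset.mem_univ i)).trans ?_
  by_contra! hlt
  have hC : 0 ≤ C := by
    have := (norm_nonneg _).trans (h N le_rfl)
    exact nonneg_of_mul_nonneg_left this (pow_pos hR _)
  let u : ι → ℂ := fun i => if α i = 0 then 1 else (α i / ‖α i‖) ^ D
  have hu : ∀ i, ‖u i‖ = 1 := by
    intro i
    simp only [u]
    split_ifs with h0
    · simp
    · simp [h0]
  have hratio : 1 < R⁻¹ * ‖α i₀‖ := by
    rw [inv_mul_eq_div, one_lt_div hR]
    exact hlt
  obtain ⟨M, hM⟩ := pow_unbounded_of_one_lt (2 * C) hratio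
  obtain ⟨n, hn, hnear⟩ := exists_pow_near_one u hu (N + M + 1)
  have hre : ∀ i, ‖α i‖ ^ (D * n) / 2 ≤ (α i ^ (D * n)).re := by
    intro i
    by_cases h0 : α i = 0
    · have : D * n ≠ 0 := mul_ne_zero hD (by omega)
      simp [h0, this]
    · have h1 : α i ^ (D * n) = ((‖α i‖ ^ (D * n) : ℝ) : ℂ) * u i ^ n := by
        simp only [u, h0, if_false]
        rw [← pow_mul, Complex.ofReal_pow, ← mul_pow, mul_div_cancel₀]
        simpa using h0
      have h2 : 1 / 2 ≤ (u i ^ n).re := by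
        have := (Complex.abs_re_le_norm _).trans (hnear i).le
        rw [Complex.sub_re, Complex.one_re] at this
        have := (abs_le.1 this).1
        linarith
      rw [h1, Complex.re_ofReal_mul]
      have : 0 ≤ ‖α i‖ ^ (D * n) := by positivity
      nlinarith
  have h1 : ‖α i₀‖ ^ (D * n) / 2 ≤ ‖∑ i, α i ^ (D * n)‖ := by
    refine le_trans ?_ (Complex.re_le_norm _)
    rw [Complex.re_sum]
    refine (hre i₀).trans (Finset.single_le_sum (f := fun i => (α i ^ (D * n)).re)
      (fun i _ => le_trans (by positivity) (hre i)) (Finset.mem_univ i₀))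
  have h2 := h1.trans (h n (by omega))
  have h3 : (R⁻¹ * ‖α i₀‖) ^ (D * n) ≤ 2 * C := by
    rw [mul_pow, inv_pow, inv_mul_le_iff₀ (by positivity)]
    linarith
  have h4 : (R⁻¹ * ‖α i₀‖) ^ M ≤ (R⁻¹ * ‖α i₀‖) ^ (D * n) := by
    refine pow_le_pow_right₀ hratio.le ?_
    have : 1 * n ≤ D * n := Nat.mul_le_mul_right _ (Nat.one_le_iff_ne_zero.2 hD)
    omega
  linarith

theorem eq_prod_one_sub_inv_roots (p : ℂ[X]) (hp : p.coeff 0 = 1) :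
    p = (p.roots.map fun r => 1 - C r⁻¹ * X).prod := by
  have hp0 : p ≠ 0 := by
    rintro rfl
    simp at hp
  have hs := (IsAlgClosed.splits p).eq_prod_roots
  have h0 : ∀ r ∈ p.roots, r ≠ 0 := by
    rintro r hr rfl
    have := (mem_roots'.1 hr).2
    rw [IsRoot, ← coeff_zero_eq_eval_zero, hp] at this
    exact one_ne_zero this
  have h1 : (p.roots.map fun r => X - C r) =
      p.roots.map fun r => C (-r) * (1 - C r⁻¹ * X) := by
    refine Multiset.map_congr rfl fun r hr => ?_
    have : C r * C r⁻¹ = (1 : ℂ[X]) := by rw [← C_mul, mul_inv_cancel₀ (h0 r hr), C_1]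
    rw [C_neg]
    linear_combination (-X) * this
  rw [h1, Multiset.prod_map_mul] at hs
  have h2 : (p.roots.map fun r => C (-r)).prod = C (p.roots.map fun r => -r).prod := by
    rw [map_multiset_prod, Multiset.map_map]
    rfl
  rw [h2, ← mul_assoc, ← C_mul] at hs
  have h3 := congrArg (eval 0) hs
  rw [← coeff_zero_eq_eval_zero, hp, eval_mul, eval_C, eval_multiset_prod, Multiset.map_map] at h3
  have h4 : (p.roots.map (eval 0 ∘ fun r => 1 - C r⁻¹ * X)).prod = 1 := by
    simp
  rw [h4, mul_one] at h3
  rwa [← h3, C_1, one_mul] at hs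

/-- `T` is minus the logarithmic derivative of the power series `P`, multiplied by `X`. -/
def PowerSeries.IsNegLogDeriv (P T : PowerSeries ℂ) : Prop :=
  PowerSeries.X * PowerSeries.derivative ℂ P = -(P * T)

namespace PowerSeries.IsNegLogDeriv
open PowerSeries

theorem one : IsNegLogDeriv 1 0 := by
  simp [IsNegLogDeriv]

theorem mul {P T P' T' : PowerSeries ℂ} (h : IsNegLogDeriv P T) (h' : IsNegLogDeriv P' T') :
    IsNegLogDeriv (P * P') (T + T') := by
  unfold IsNegLogDeriv at *
  rw [Derivation.leibniz, smul_eq_mul, smul_eq_mul]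
  linear_combination P' * h + P * h'

theorem prod {ι : Type*} (s : Finset ι) {P T : ι → PowerSeries ℂ}
    (h : ∀ i ∈ s, IsNegLogDeriv (P i) (T i)) : IsNegLogDeriv (∏ i ∈ s, P i) (∑ i ∈ s, T i) := by
  classical
  induction s using Finset.induction_on with
  | empty => simpa using one
  | insert i s hi ih =>
    rw [Finset.prod_insert hi, Finset.sum_insert hi]
    exact (h i (Finset.mem_insert_self _ _)).mul
      (ih fun j hj => h j (Finset.mem_insert_of_mem hj))

theorem one_sub (c : ℂ) {k : ℕ} (hk : k ≠ 0) : IsNegLogDeriv (1 - C c * X ^ k)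
    (mk fun n => if k ∣ n ∧ n ≠ 0 then k * c ^ (n / k) else 0) := by
  unfold IsNegLogDeriv
  ext n
  rcases n with _ | n
  · simp
  rw [mul_comm X, coeff_succ_mul_X, coeff_derivative, map_neg, sub_mul, one_mul, mul_assoc,
    map_sub, map_sub, coeff_C_mul, coeff_C_mul, coeff_X_pow_mul', coeff_mk, coeff_one, coeff_X_pow,
    if_neg n.succ_ne_zero, zero_sub]
  by_cases h1 : n + 1 = k
  · subst h1
    simp
    ring
  rw [if_neg h1]
  by_cases h2 : k ≤ n + 1
  · have h3 : n + 1 - k ≠ 0 := by omega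
    have h4 : (k ∣ n + 1 - k) ↔ k ∣ n + 1 := by
      rw [Nat.dvd_sub_iff_left h2 dvd_rfl]
    rw [if_pos h2, coeff_mk]
    simp only [h3, h4, ne_eq, not_false_eq_true, and_true, n.succ_ne_zero]
    split_ifs with h5
    · obtain ⟨t, ht⟩ := h5
      have hkp : 0 < k := Nat.pos_of_ne_zero hk
      have : n + 1 - k = k * (t - 1) := by rw [ht, Nat.mul_sub, mul_one]
      rw [this, ht, Nat.mul_div_cancel_left _ hkp, Nat.mul_div_cancel_left _ hkp]
      obtain ⟨t, rfl⟩ : ∃ t', t = t' + 1 := ⟨t - 1, by rcases t with _ | t <;> simp_all⟩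
      simp
      ring
    · simp
  · have h5 : ¬ k ∣ n + 1 := fun h => h2 (Nat.le_of_dvd n.succ_pos h)
    simp [h2, h5]

theorem coeff_eq_zero {P T : PowerSeries ℂ} (h : IsNegLogDeriv P T) {N : ℕ} (hN : N ≠ 0)
    (h0 : coeff 0 P = 1) (hP : ∀ n, 1 ≤ n → n ≤ N → coeff n P = 0) : coeff N T = 0 := by
  obtain ⟨N, rfl⟩ := Nat.exists_eq_succ_of_ne_zero hN
  have h1 := congrArg (coeff (N + 1)) h
  rw [mul_comm X, coeff_succ_mul_X, coeff_derivative, hP _ (by omega) le_rfl, zero_mul, map_neg,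
    coeff_mul, Finset.sum_eq_single (0, N + 1)] at h1
  · simpa [h0] using h1
  · rintro ⟨i, j⟩ hij hne
    rw [Finset.HasAntidiagonal.mem_antidiagonal] at hij
    have : i ≠ 0 := by
      rintro rfl
      apply hne
      simp_all
    simp only at hij ⊢
    rw [hP i (by omega) (by omega), zero_mul]
  · intro hnot
    simp at hnot

end PowerSeries.IsNegLogDeriv

theorem Polynomial.Monic.dvd_irreducible_iff_eq {F : Type*} [Field F] {Q R : F[X]}
    (hQ : Q.Monic) (hQi : Irreducible Q)
    (hR : R.Monic) (hRi : Irreducible R) : Q ∣ R ↔ Q = R := by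
  constructor
  · intro h
    exact eq_of_monic_of_associated hQ hR ((hQi.dvd_irreducible_iff_associated hRi).1 h)
  · rintro rfl
    exact dvd_rfl

section
variable (F : Type*) [Field F] [Fintype F]

theorem finite_monic_natDegree_eq (n : ℕ) : {f : F[X] | f.Monic ∧ f.natDegree = n}.Finite := by
  have h : Finite (degreeLT F n) := Finite.of_equiv _ (degreeLTEquiv F n).symm.toEquiv
  exact Finite.of_equiv _ (monicEquivDegreeLT (R := F) n).symm

/-- The finite set of monic polynomials of degree `n`. -/
noncomputable def monicsOfDegree (n : ℕ) : Finset F[X] := (finite_monic_natDegree_eq F n).toFinset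

variable {F}

theorem mem_monicsOfDegree {n : ℕ} {f : F[X]} :
    f ∈ monicsOfDegree F n ↔ f.Monic ∧ f.natDegree = n := by
  simp [monicsOfDegree]

variable (F) in
theorem card_monicsOfDegree (n : ℕ) : (monicsOfDegree F n).card = Fintype.card F ^ n := by
  have h1 : (monicsOfDegree F n).card = Nat.card {f : F[X] // f.Monic ∧ f.natDegree = n} := by
    rw [monicsOfDegree, ← Set.ncard_eq_toFinset_card _ (finite_monic_natDegree_eq F n),
      ← Nat.card_coe_set_eq]
    rfl
  rw [h1, Nat.card_congr (monicEquivDegreeLT (R := F) n),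
    Nat.card_congr (degreeLTEquiv F n).toEquiv, Nat.card_eq_fintype_card, Fintype.card_fun,
    Fintype.card_fin]

variable (F) in
open Classical in
/-- The finite set of monic irreducible polynomials of degree at most `N`. -/
noncomputable def monicPrimes (N : ℕ) : Finset F[X] :=
  ((Finset.range (N + 1)).biUnion (monicsOfDegree F)).filter Irreducible

theorem mem_monicPrimes {N : ℕ} {f : F[X]} :
    f ∈ monicPrimes F N ↔ f.Monic ∧ Irreducible f ∧ f.natDegree ≤ N := by
  simp only [monicPrimes, Finset.mem_filter, Finset.mem_biUnion, Finset.mem_range,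
    mem_monicsOfDegree]
  constructor
  · rintro ⟨⟨n, hn, h1, h2⟩, h3⟩
    exact ⟨h1, h3, by omega⟩
  · rintro ⟨h1, h2, h3⟩
    exact ⟨⟨_, by omega, h1, rfl⟩, h2⟩

open Classical in
theorem mul_prod_one_sub_eq (χ : F[X] →* ℂ) (T : Finset F[X])
    (hT : ∀ Q ∈ T, Q.Monic ∧ Irreducible Q) :
    (PowerSeries.mk fun n => ∑ f ∈ monicsOfDegree F n, χ f) *
      ∏ Q ∈ T, (1 - PowerSeries.C (χ Q) * PowerSeries.X ^ Q.natDegree) =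
    PowerSeries.mk fun n => ∑ f ∈ (monicsOfDegree F n).filter fun f => ∀ Q ∈ T, ¬ Q ∣ f, χ f := by
  induction T using Finset.induction_on with
  | empty => simp
  | insert Q T hQT ih =>
    obtain ⟨hQm, hQi⟩ := hT Q (Finset.mem_insert_self _ _)
    rw [Finset.prod_insert hQT, mul_left_comm,
      ih fun R hR => hT R (Finset.mem_insert_of_mem hR)]
    ext n
    rw [sub_mul, one_mul, mul_assoc, map_sub, PowerSeries.coeff_C_mul, PowerSeries.coeff_X_pow_mul',
      PowerSeries.coeff_mk, PowerSeries.coeff_mk, PowerSeries.coeff_mk, sub_eq_iff_eq_add,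
      ← Finset.sum_filter_add_sum_filter_not _ (fun f => ¬ Q ∣ f), Finset.filter_filter,
      Finset.filter_filter]
    congr 1
    · refine Finset.sum_congr (Finset.filter_congr fun f _ => ?_) fun _ _ => rfl
      rw [Finset.forall_mem_insert, and_comm]
    · split_ifs with hn
      · rw [Finset.mul_sum]
        symm
        refine Finset.sum_nbij (fun g => Q * g) ?_ ?_ ?_ ?_
        · intro g hg
          simp only [Finset.mem_filter, mem_monicsOfDegree] at hg ⊢
          obtain ⟨⟨h1, h2⟩, h3⟩ := hg
          refine ⟨⟨hQm.mul h1, ?_⟩, ?_, ?_⟩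
          · rw [hQm.natDegree_mul h1]
            omega
          · intro R hR hd
            obtain ⟨hRm, hRi⟩ := hT R (Finset.mem_insert_of_mem hR)
            rcases hRi.prime.dvd_or_dvd hd with h | h
            · rw [hRm.dvd_irreducible_iff_eq hRi hQm hQi] at h
              exact hQT (h ▸ hR)
            · exact h3 R hR h
          · simp
        · intro a _ b _ hab
          exact mul_left_cancel₀ hQm.ne_zero hab
        · intro f hf
          simp only [Finset.coe_filter, mem_monicsOfDegree, Set.mem_ofPred_eq, not_not] at hf
          obtain ⟨⟨h1, h2⟩, h3, ⟨g, rfl⟩⟩ := hf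
          have hg : g.Monic := hQm.of_mul_monic_left h1
          refine ⟨g, ?_, rfl⟩
          simp only [Finset.coe_filter, mem_monicsOfDegree, Set.mem_ofPred_eq]
          refine ⟨⟨hg, ?_⟩, fun R hR hd => h3 R hR (hd.mul_left _)⟩
          rw [hQm.natDegree_mul hg] at h2
          omega
        · intro g _
          exact (map_mul χ _ _).symm
      · rw [mul_zero]
        refine Finset.sum_eq_zero fun f hf => ?_
        exfalso
        simp only [Finset.mem_filter, mem_monicsOfDegree, not_not] at hf
        exact hn (hf.1.2 ▸ natDegree_le_of_dvd hf.2.2 hf.1.1.ne_zero)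

/-- The Euler product, truncated at degree `N`. -/
theorem coeff_mul_prod_one_sub (χ : F[X] →* ℂ) {n N : ℕ} (hn : n ≤ N) :
    PowerSeries.coeff n ((PowerSeries.mk fun n => ∑ f ∈ monicsOfDegree F n, χ f) *
      ∏ Q ∈ monicPrimes F N, (1 - PowerSeries.C (χ Q) * PowerSeries.X ^ Q.natDegree)) =
    if n = 0 then 1 else 0 := by
  classical
  rw [mul_prod_one_sub_eq χ _ fun Q hQ => ⟨(mem_monicPrimes.1 hQ).1, (mem_monicPrimes.1 hQ).2.1⟩,
    PowerSeries.coeff_mk]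
  split_ifs with h0
  · subst h0
    have : ((monicsOfDegree F 0).filter fun f => ∀ Q ∈ monicPrimes F N, ¬ Q ∣ f) = {1} := by
      ext f
      simp only [Finset.mem_filter, mem_monicsOfDegree, Finset.mem_singleton]
      constructor
      · rintro ⟨⟨h1, h2⟩, -⟩
        exact h1.natDegree_eq_zero.1 h2
      · rintro rfl
        exact ⟨⟨monic_one, natDegree_one⟩, fun Q hQ hd =>
          (mem_monicPrimes.1 hQ).2.1.not_isUnit (isUnit_of_dvd_one hd)⟩
    rw [this, Finset.sum_singleton, map_one]
  · refine Finset.sum_eq_zero fun f hf => ?_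
    exfalso
    simp only [Finset.mem_filter, mem_monicsOfDegree] at hf
    obtain ⟨⟨h1, h2⟩, h3⟩ := hf
    have hu : ¬ IsUnit f := fun hu => h0 (h2 ▸ natDegree_eq_zero_of_isUnit hu)
    obtain ⟨Q, hQm, hQi, hQd⟩ := exists_monic_irreducible_factor f hu
    exact h3 Q (mem_monicPrimes.2 ⟨hQm, hQi, (natDegree_le_of_dvd hQd h1.ne_zero).trans
      (h2.le.trans hn)⟩) hQd

theorem sum_mulChar_monicsOfDegree_eq_zero {P : F[X]} (hP : P.Monic)
    {ψ : MulChar (F[X] ⧸ Ideal.span {P}) ℂ} (hψ : ψ ≠ 1) {n : ℕ} (hn : P.natDegree ≤ n) :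
    ∑ f ∈ monicsOfDegree F n, ψ (Ideal.Quotient.mk (Ideal.span {P}) f) = 0 := by
  classical
  have hrep : ∀ y : F[X] ⧸ Ideal.span {P}, ∃ r : F[X], r.degree < P.degree ∧
      Ideal.Quotient.mk (Ideal.span {P}) r = y := by
    intro y
    obtain ⟨g, rfl⟩ := Ideal.Quotient.mk_surjective y
    refine ⟨g %ₘ P, degree_modByMonic_lt _ hP, ?_⟩
    rw [Ideal.Quotient.eq, Ideal.mem_span_singleton, ← dvd_neg, neg_sub]
    exact ⟨g /ₘ P, by linear_combination -modByMonic_add_div g P⟩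
  choose r hr hry using hrep
  have hfin : Finite (F[X] ⧸ Ideal.span {P}) := by
    have : Finite (degreeLT F P.natDegree) :=
      Finite.of_equiv _ (degreeLTEquiv F P.natDegree).symm.toEquiv
    refine Finite.of_injective (fun y => (⟨r y, ?_⟩ : degreeLT F P.natDegree)) ?_
    · rw [mem_degreeLT, ← degree_eq_natDegree hP.ne_zero]
      exact hr y
    · intro y z hyz
      rw [← hry y, ← hry z, show r y = r z from congrArg Subtype.val hyz]
  have := Fintype.ofFinite (F[X] ⧸ Ideal.span {P})
  have hmon : ∀ y, ∀ f ∈ monicsOfDegree F n, f + r y ∈ monicsOfDegree F n ∧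
      f - r y ∈ monicsOfDegree F n := by
    intro y f hf
    rw [mem_monicsOfDegree] at hf
    have h1 : (r y).degree < f.degree := by
      refine (hr y).trans_le ?_
      rw [degree_eq_natDegree hP.ne_zero, degree_eq_natDegree hf.1.ne_zero, hf.2]
      exact_mod_cast hn
    simp only [mem_monicsOfDegree]
    refine ⟨⟨hf.1.add_of_left h1, ?_⟩, hf.1.sub_of_left h1, ?_⟩
    · rw [natDegree_add_eq_left_of_degree_lt h1, hf.2]
    · rw [sub_eq_add_neg, natDegree_add_eq_left_of_degree_lt (by rwa [degree_neg]), hf.2]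
  have hshift : ∀ y, ∑ f ∈ monicsOfDegree F n, ψ (Ideal.Quotient.mk (Ideal.span {P}) f) =
      ∑ f ∈ monicsOfDegree F n, ψ (Ideal.Quotient.mk (Ideal.span {P}) f + y) := by
    intro y
    refine Finset.sum_bij' (fun f _ => f - r y) (fun f _ => f + r y)
      (fun f hf => (hmon y f hf).2) (fun f hf => (hmon y f hf).1) ?_ ?_ ?_
    · intros; ring
    · intros; ring
    · intro f _
      rw [map_sub, hry]
      congr 1
      ring
  have hsum : ∑ _y : F[X] ⧸ Ideal.span {P}, ∑ f ∈ monicsOfDegree F n,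
      ψ (Ideal.Quotient.mk (Ideal.span {P}) f) = 0 := by
    rw [Finset.sum_congr rfl fun y _ => hshift y, Finset.sum_comm]
    refine Finset.sum_eq_zero fun f _ => ?_
    refine (Fintype.sum_equiv (Equiv.addLeft (Ideal.Quotient.mk (Ideal.span {P}) f)) _ ψ
      fun y => rfl).trans ?_
    exact MulChar.sum_eq_zero_of_ne_one hψ
  rw [Finset.sum_const, Finset.card_univ, smul_eq_zero] at hsum
  exact hsum.resolve_left Fintype.card_ne_zero

end

theorem FiniteField.frobeniusAlgHom_pow_apply {F K : Type*} [Field F] [Fintype F] [Field K]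
    [Algebra F K] (i : ℕ) (x : K) :
    (FiniteField.frobeniusAlgHom F K ^ i) x = x ^ Fintype.card F ^ i := by
  induction i generalizing x with
  | zero => simp
  | succ i ih =>
    rw [pow_succ, AlgHom.mul_apply, ih, FiniteField.coe_frobeniusAlgHom, ← pow_mul, pow_succ']

section
variable {F K : Type*} [Field F] [Fintype F] [Field K] [Fintype K] [Algebra F K]

variable (F) in
theorem pow_card_pow_natDegree_minpoly (x : K) :
    x ^ Fintype.card F ^ (minpoly F x).natDegree = x := by
  have hx : IsIntegral F x := .of_finite F x
  have h := ((minpoly.irreducible hx).natDegree_dvd_iff_dvd_X_pow_card_pow_sub_X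
    (n := (minpoly F x).natDegree)).1 dvd_rfl
  have h2 := (minpoly.dvd_iff (A := F) (x := x)).1 h
  simpa [sub_eq_zero, Nat.card_eq_fintype_card] using h2

variable (F) in
theorem injOn_pow_card_pow (x : K) : Set.InjOn (fun i : ℕ => x ^ Fintype.card F ^ i)
    (Finset.range (minpoly F x).natDegree : Set ℕ) := by
  have hx : IsIntegral F x := .of_finite F x
  have key : ∀ i j : ℕ, j < (minpoly F x).natDegree → i < j →
      x ^ Fintype.card F ^ i ≠ x ^ Fintype.card F ^ j := by
    intro i j hj hij heq
    obtain ⟨t, rfl⟩ := Nat.exists_eq_add_of_lt hij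
    rw [add_assoc, pow_add, mul_comm, pow_mul, ← FiniteField.frobeniusAlgHom_pow_apply,
      ← FiniteField.frobeniusAlgHom_pow_apply (F := F) i] at heq
    have h1 := (FiniteField.frobeniusAlgHom F K ^ i).toRingHom.injective heq
    have h2 : minpoly F x ∣ X ^ Nat.card F ^ (t + 1) - X := by
      rw [minpoly.dvd_iff]
      simp [← h1, Nat.card_eq_fintype_card]
    have h3 := (minpoly.irreducible hx).natDegree_dvd_of_dvd_X_pow_card_pow_sub_X h2
    have := Nat.le_of_dvd t.succ_pos h3
    omega
  intro i hi j hj heq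
  simp only [Finset.coe_range, Set.mem_Iio] at hi hj
  rcases lt_trichotomy i j with h | h | h
  · exact absurd heq (key i j hj h)
  · exact h
  · exact absurd heq.symm (key j i hi h)

variable (F) in
theorem map_minpoly_eq_prod (x : K) : (minpoly F x).map (algebraMap F K) =
    ∏ i ∈ Finset.range (minpoly F x).natDegree, (X - C (x ^ Fintype.card F ^ i)) := by
  classical
  have hx : IsIntegral F x := .of_finite F x
  have hm := (minpoly.monic hx).map (algebraMap F K)
  have hp : (∏ i ∈ Finset.range (minpoly F x).natDegree,
      (X - C (x ^ Fintype.card F ^ i))).Monic :=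
    monic_prod_of_monic _ _ fun i _ => monic_X_sub_C _
  refine eq_of_monic_of_dvd_of_natDegree_le hp hm ?_ ?_
  · refine Finset.prod_dvd_of_coprime ?_ ?_
    · intro i hi j hj hij
      exact isCoprime_X_sub_C_of_isUnit_sub
        (sub_ne_zero.2 fun h => hij (injOn_pow_card_pow F x hi hj h)).isUnit
    · intro i _
      rw [dvd_iff_isRoot, IsRoot, eval_map_algebraMap, ← FiniteField.frobeniusAlgHom_pow_apply,
        aeval_algHom_apply, minpoly.aeval, map_zero]
  · rw [natDegree_prod_of_monic _ _ fun i _ => monic_X_sub_C _]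
    simp only [natDegree_map, natDegree_X_sub_C]
    simp

variable (F) in
theorem prod_range_sub_conj_of_dvd (x z : K) {n : ℕ} (hn : (minpoly F x).natDegree ∣ n) :
    ∏ j ∈ Finset.range n, (z - x ^ Fintype.card F ^ j) =
      (aeval z (minpoly F x)) ^ (n / (minpoly F x).natDegree) := by
  have h1 : aeval z (minpoly F x) =
      ∏ j ∈ Finset.range (minpoly F x).natDegree, (z - x ^ Fintype.card F ^ j) := by
    rw [← eval_map_algebraMap, map_minpoly_eq_prod, eval_prod]
    simp
  have hx : IsIntegral F x := .of_finite F x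
  have hk := minpoly.natDegree_pos hx
  have hxk := pow_card_pow_natDegree_minpoly F x
  rw [h1]
  obtain ⟨t, rfl⟩ := hn
  rw [Nat.mul_div_cancel_left _ hk]
  generalize (minpoly F x).natDegree = k at *
  have hper : ∀ t, x ^ Fintype.card F ^ (k * t) = x := by
    intro t
    induction t with
    | zero => simp
    | succ t ih => rw [mul_add, mul_one, pow_add, pow_mul, ih, hxk]
  induction t with
  | zero => simp
  | succ t ih =>
    rw [mul_add, mul_one, Finset.prod_range_add, ih, pow_succ]
    congr 1
    refine Finset.prod_congr rfl fun j _ => ?_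
    rw [pow_add, pow_mul, hper]

theorem Finset.prod_range_add_eq_of_periodic {M : Type*} [CommMonoid M] (g : ℕ → M) {n : ℕ}
    (hg : ∀ j, g (j + n) = g j) (i : ℕ) :
    ∏ j ∈ Finset.range n, g (j + i) = ∏ j ∈ Finset.range n, g j := by
  induction i with
  | zero => simp
  | succ i ih =>
    rw [← ih]
    have h1 := Finset.prod_range_succ (fun j => g (j + i)) n
    rw [Finset.prod_range_succ'] at h1
    simp only [zero_add] at h1
    rw [add_comm n i, hg] at h1
    rcases n with _ | n
    · simp
    · rw [Finset.prod_range_succ' (fun j => g (j + i)), Finset.prod_range_succ]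
      congr 1
      · refine Finset.prod_congr rfl fun j _ => by congr 1; omega
      · rw [zero_add, ← hg i]
        congr 1
        omega

/-- Reciprocity between the minimal polynomials of `x` and of `θ`. -/
theorem aeval_minpoly_pow_eq (x θ : K) {n e : ℕ} (hn : Module.finrank F K = n) (he : Even e) :
    (aeval θ (minpoly F x) ^ (n / (minpoly F x).natDegree)) ^
        ((∑ i ∈ Finset.range (minpoly F θ).natDegree, Fintype.card F ^ i) * e) =
      (aeval x (minpoly F θ)) ^ ((∑ j ∈ Finset.range n, Fintype.card F ^ j) * e) := by
  have hx : IsIntegral F x := .of_finite F x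
  have hdvd : (minpoly F x).natDegree ∣ n := hn ▸ minpoly.degree_dvd hx
  rw [← prod_range_sub_conj_of_dvd F x θ hdvd]
  have hper : ∀ j, x ^ Fintype.card F ^ (j + n) = x ^ Fintype.card F ^ j := by
    intro j
    rw [add_comm, pow_add, pow_mul, ← hn, ← Module.card_eq_pow_finrank, FiniteField.pow_card]
  have h1 : (∏ j ∈ Finset.range n, (θ - x ^ Fintype.card F ^ j)) ^
      (∑ i ∈ Finset.range (minpoly F θ).natDegree, Fintype.card F ^ i) =
      ∏ j ∈ Finset.range n, ∏ i ∈ Finset.range (minpoly F θ).natDegree,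
        (θ ^ Fintype.card F ^ i - x ^ Fintype.card F ^ j) := by
    rw [← Finset.prod_pow_eq_pow_sum, Finset.prod_comm]
    refine Finset.prod_congr rfl fun i _ => ?_
    rw [← FiniteField.frobeniusAlgHom_pow_apply, map_prod]
    refine Eq.trans ?_ (Finset.prod_range_add_eq_of_periodic
      (fun j => θ ^ Fintype.card F ^ i - x ^ Fintype.card F ^ j) (fun j => by rw [hper]) i)
    refine Finset.prod_congr rfl fun j _ => ?_
    rw [map_sub, FiniteField.frobeniusAlgHom_pow_apply, FiniteField.frobeniusAlgHom_pow_apply,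
      ← pow_mul, ← pow_add]
  have h2 : ∀ j, ∏ i ∈ Finset.range (minpoly F θ).natDegree,
      (θ ^ Fintype.card F ^ i - x ^ Fintype.card F ^ j) =
      (-1) ^ (minpoly F θ).natDegree * (aeval x (minpoly F θ)) ^ Fintype.card F ^ j := by
    intro j
    rw [← FiniteField.frobeniusAlgHom_pow_apply j, ← FiniteField.frobeniusAlgHom_pow_apply j,
      ← aeval_algHom_apply, ← eval_map_algebraMap, map_minpoly_eq_prod, eval_prod]
    have : ((-1 : K)) ^ (minpoly F θ).natDegree =
        ∏ i ∈ Finset.range (minpoly F θ).natDegree, (-1 : K) := by simp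
    rw [this, ← Finset.prod_mul_distrib]
    refine Finset.prod_congr rfl fun i _ => ?_
    simp
  rw [pow_mul, h1, Finset.prod_congr rfl fun j _ => h2 j, Finset.prod_mul_distrib,
    Finset.prod_pow_eq_pow_sum, mul_pow, ← pow_mul,
    Finset.prod_pow_eq_pow_sum, ← pow_mul, (he.mul_left _).neg_one_pow, one_mul]

open Classical in
theorem card_filter_minpoly_eq {Q : F[X]} (hQ : Q.Monic) (hQi : Irreducible Q)
    (hdvd : Q.natDegree ∣ Module.finrank F K) :
    (Finset.univ.filter fun x : K => minpoly F x = Q).card = Q.natDegree := by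
  have : Fact (Irreducible Q) := ⟨hQi⟩
  have hfr : Module.finrank F (AdjoinRoot Q) = Q.natDegree := finrank_quotient_span_eq_natDegree
  obtain ⟨φ⟩ := FiniteField.nonempty_algHom_of_finrank_dvd (F := F) (K := AdjoinRoot Q) (L := K)
    (by rwa [hfr])
  obtain ⟨y, hy⟩ : ∃ y : K, aeval y Q = 0 := by
    refine ⟨φ (AdjoinRoot.root Q), ?_⟩
    rw [aeval_algHom_apply]
    simp
  have hmy : minpoly F y = Q := (minpoly.eq_of_irreducible_of_monic hQi hy hQ).symm
  have : (Finset.univ.filter fun x : K => minpoly F x = Q) =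
      (Finset.range Q.natDegree).image fun i => y ^ Fintype.card F ^ i := by
    ext x
    simp only [Finset.mem_filter, Finset.mem_univ, true_and, Finset.mem_image]
    constructor
    · intro hx
      have h0 : eval x (Q.map (algebraMap F K)) = 0 := by
        rw [eval_map_algebraMap, ← hx, minpoly.aeval]
      rw [← hmy, map_minpoly_eq_prod, eval_prod, Finset.prod_eq_zero_iff] at h0
      obtain ⟨i, hi, h⟩ := h0
      refine ⟨i, hmy ▸ hi, ?_⟩
      simpa [sub_eq_zero, eq_comm] using h
    · rintro ⟨i, -, rfl⟩
      refine (minpoly.eq_of_irreducible_of_monic hQi ?_ hQ).symm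
      rw [← FiniteField.frobeniusAlgHom_pow_apply, aeval_algHom_apply, hy, map_zero]
  rw [this, Finset.card_image_of_injOn, Finset.card_range]
  have := injOn_pow_card_pow F y
  rwa [hmy] at this

theorem sum_monicPrimes_eq_sum_minpoly (χ : F[X] →* ℂ) {n : ℕ} (hn : Module.finrank F K = n) :
    (∑ Q ∈ monicPrimes F n,
      if Q.natDegree ∣ n ∧ n ≠ 0 then (Q.natDegree : ℂ) * χ Q ^ (n / Q.natDegree) else 0) =
    ∑ x : K, χ (minpoly F x ^ (n / (minpoly F x).natDegree)) := by
  classical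
  have hn0 : 0 < n := hn ▸ Module.finrank_pos
  have hmem : ∀ x ∈ (Finset.univ : Finset K), minpoly F x ∈ monicPrimes F n := by
    intro x _
    have hx : IsIntegral F x := .of_finite F x
    exact mem_monicPrimes.2 ⟨minpoly.monic hx, minpoly.irreducible hx,
      Nat.le_of_dvd hn0 (hn ▸ minpoly.degree_dvd hx)⟩
  rw [← Finset.sum_fiberwise_of_maps_to hmem]
  refine Finset.sum_congr rfl fun Q hQ => ?_
  obtain ⟨h1, h2, h3⟩ := mem_monicPrimes.1 hQ
  have h4 : ∀ x ∈ Finset.univ.filter (fun x : K => minpoly F x = Q),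
      χ (minpoly F x ^ (n / (minpoly F x).natDegree)) = χ Q ^ (n / Q.natDegree) := by
    intro x hx
    rw [(Finset.mem_filter.1 hx).2, map_pow]
  rw [Finset.sum_congr rfl h4, Finset.sum_const, nsmul_eq_mul]
  split_ifs with h
  · rw [card_filter_minpoly_eq h1 h2 (hn ▸ h.1)]
  · have : (Finset.univ.filter fun x : K => minpoly F x = Q) = ∅ := by
      rw [Finset.filter_eq_empty_iff]
      rintro x - rfl
      exact h ⟨hn ▸ minpoly.degree_dvd (.of_finite F x), hn0.ne'⟩
    simp [this]

end

/-- Transfer of the Stepanov bound to cubic character sums. -/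
theorem norm_sum_cubic_mulChar_le {k K : Type*} [Field k] [Fintype k] [Field K] [Fintype K]
    (ι : k →+* K) {ψ : MulChar k ℂ} (hψ3 : ψ ^ 3 = 1) (hψ1 : ψ ≠ 1) (u : K → k)
    (f h : K[X]) (θ : K) (hf : f = (X - C θ) * h) (hθ : h.eval θ ≠ 0) {s A b : ℕ}
    (hb : Fintype.card k = 3 * b + 1) (hs : Fintype.card K = s ^ 2)
    (hA : Fintype.card K = 3 * A + 1) (h3 : 3 ≤ s)
    (hu : ∀ x, ι (u x) ^ b = f.eval x ^ A) :
    ‖∑ x, ψ (u x)‖ ≤ (21 * f.natDegree + 18) * s := by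
  classical
  have hf0 : f ≠ 0 := by
    rintro rfl
    rcases mul_eq_zero.1 hf.symm with h1 | h1
    · exact X_sub_C_ne_zero θ h1
    · simp [h1] at hθ
  have hb0 : b ≠ 0 := by
    rintro rfl
    have := Fintype.one_lt_card (α := k)
    omega
  have hA0 : A ≠ 0 := by
    rintro rfl
    have := Fintype.one_lt_card (α := K)
    omega
  obtain ⟨g, hg⟩ := IsCyclic.exists_generator (α := kˣ)
  set w : ℂ := ψ g with hw
  have hw3 : w ^ 3 = 1 := by
    rw [hw, ← MulChar.pow_apply_coe, hψ3, MulChar.one_apply_coe]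
  have hw1 : w ≠ 1 := by
    intro h1
    refine hψ1 ((MulChar.eq_iff hg ψ 1).2 ?_)
    rw [MulChar.one_apply_coe]
    exact h1
  have hws : 1 + w + w ^ 2 = 0 := by
    have : (w - 1) * (1 + w + w ^ 2) = 0 := by linear_combination hw3
    exact (mul_eq_zero.1 this).resolve_left (sub_ne_zero.2 hw1)
  have hwn : ‖w‖ = 1 := by
    have : ‖w‖ ^ 3 = 1 := by rw [← norm_pow, hw3, norm_one]
    exact (pow_eq_one_iff_of_nonneg (norm_nonneg _) (by norm_num)).1 this
  set ω : K := ι g ^ b with hω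
  have hω3 : ω ^ 3 = 1 := by
    have h1 : (g : k) ^ (b * 3) = 1 := by
      have := FiniteField.pow_card_sub_one_eq_one (g : k) g.ne_zero
      rwa [hb, Nat.add_sub_cancel, mul_comm] at this
    rw [hω, ← pow_mul, ← map_pow, h1, map_one]
  have hω1 : ω ≠ 1 := by
    intro h1
    rw [hω, ← map_pow, map_eq_one_iff ι ι.injective] at h1
    have h2 : g ^ b = 1 := by ext; simpa using h1
    have h4 := orderOf_dvd_of_pow_eq_one h2
    rw [orderOf_eq_card_of_forall_mem_zpowers hg, Nat.card_eq_fintype_card,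
      Fintype.card_units, hb, Nat.add_sub_cancel] at h4
    have := Nat.le_of_dvd (Nat.pos_of_ne_zero hb0) h4
    omega
  have hω0 : ω ≠ 0 := by
    intro h1
    rw [h1] at hω3
    norm_num at hω3
  have hω2 : ω ^ 2 ≠ 1 := by
    intro h1
    apply hω1
    have : ω ^ 3 = ω * ω ^ 2 := by ring
    rw [hω3, h1, mul_one] at this
    exact this.symm
  have hω12 : ω ^ 2 ≠ ω := by
    intro h1
    apply hω1
    have : ω * (ω - 1) = 0 := by linear_combination h1
    exact sub_eq_zero.1 ((mul_eq_zero.1 this).resolve_left hω0)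
  set N : ℕ → ℕ := fun c => (Finset.univ.filter fun x => f.eval x ^ A = ω ^ c).card with hN
  have hval : ∀ x, (f.eval x = 0 ∧ ψ (u x) = 0) ∨ (f.eval x ≠ 0 ∧ ∃ c, (c = 0 ∨ c = 1 ∨ c = 2) ∧
      f.eval x ^ A = ω ^ c ∧ ψ (u x) = w ^ c) := by
    intro x
    by_cases hx : u x = 0
    · left
      have h1 := hu x
      rw [hx, map_zero, zero_pow hb0] at h1
      refine ⟨(pow_eq_zero_iff hA0).1 h1.symm, ?_⟩
      rw [hx, MulChar.map_zero]
    · right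
      have h1 := hu x
      constructor
      · intro h0
        rw [h0, zero_pow hA0, pow_eq_zero_iff hb0, map_eq_zero] at h1
        exact hx h1
      · obtain ⟨m, hm⟩ := mem_powers_iff_mem_zpowers.2 (hg (Units.mk0 (u x) hx))
        have hm' : u x = (g : k) ^ m := by
          have := congrArg Units.val hm
          simpa using this.symm
        refine ⟨m % 3, by omega, ?_, ?_⟩
        · rw [← h1, hm', map_pow, ← pow_mul, mul_comm, pow_mul, ← hω, ← pow_mod_orderOf,
            orderOf_eq_prime hω3 hω1]
        · rw [hm', map_pow, ← hw, ← pow_mod_orderOf, orderOf_eq_prime hw3 hw1]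
  have hsum : ∑ x, ψ (u x) = N 0 + N 1 * w + N 2 * w ^ 2 := by
    simp only [hN, Finset.card_filter, Nat.cast_sum, Finset.sum_mul, ← Finset.sum_add_distrib]
    refine Finset.sum_congr rfl fun x _ => ?_
    rcases hval x with ⟨h1, h2⟩ | ⟨h1, c, rfl | rfl | rfl, h2, h4⟩
    · have : ∀ c, ω ^ c ≠ 0 := fun c => pow_ne_zero c hω0
      simp [h1, h2, zero_pow hA0, (this _).symm, hω0.symm]
    · simp [h2, h4, hω1.symm, hω2.symm]
    · simp [h2, h4, hω1, hω12.symm]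
    · simp [h2, h4, hω2, hω12]
  have hcount : s ^ 2 ≤ N 0 + N 1 + N 2 + f.natDegree := by
    have h1 : (Finset.univ.filter fun x => f.eval x = 0).card ≤ f.natDegree := by
      refine le_trans (Finset.card_le_card (t := f.roots.toFinset) ?_)
        (f.roots.toFinset_card_le.trans f.card_roots')
      intro x hx
      simpa [hf0] using hx
    refine le_trans ?_ (Nat.add_le_add_left h1 _)
    simp only [hN, Finset.card_filter, ← Finset.sum_add_distrib]
    rw [← hs, ← Finset.card_univ, Finset.card_eq_sum_ones]
    refine Finset.sum_le_sum fun x _ => ?_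
    rcases hval x with ⟨h1, h2⟩ | ⟨h1, c, rfl | rfl | rfl, h2, h4⟩
    · simp [h1]
    · simp [h2]
      omega
    · simp [h2]
      omega
    · simp [h2]
      omega
  have hup : ∀ c, (N c : ℝ) ≤ s ^ 2 / 3 + (3 * f.natDegree + 3) * s := by
    intro c
    have h1 := card_eval_pow_eq_le f h θ (ω ^ c) hf hθ rfl hs hA h3 (pow_ne_zero c hω0)
    rw [hs] at h1 hA
    have h2 : ((N c * s : ℕ) : ℝ) ≤
        ((A + 2 * f.natDegree * A + (s / 3 + 2 * f.natDegree + 2) * s ^ 2 : ℕ) : ℝ) := by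
      exact_mod_cast h1
    push_cast at h2
    have h4 : ((s / 3 : ℕ) : ℝ) ≤ s / 3 := by exact_mod_cast Nat.cast_div_le (α := ℝ)
    have h5 : (A : ℝ) ≤ s ^ 2 / 3 := by
      have : (s : ℝ) ^ 2 = 3 * A + 1 := by exact_mod_cast hA
      linarith
    have hs0 : (0 : ℝ) < s := by
      have : 0 < s := by omega
      exact_mod_cast this
    have hd : (0 : ℝ) ≤ f.natDegree := Nat.cast_nonneg _
    refine le_of_mul_le_mul_right (h2.trans ?_) hs0
    have h6 : (1 + 2 * (f.natDegree : ℝ)) * A ≤ (1 + 2 * f.natDegree) * (s ^ 2 / 3) := by gcongr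
    have h7 : (((s / 3 : ℕ) : ℝ) + 2 * f.natDegree + 2) * (s : ℝ) ^ 2 ≤
      ((s : ℝ) / 3 + 2 * f.natDegree + 2) * (s : ℝ) ^ 2 := by gcongr
    have h8 : 0 ≤ (f.natDegree : ℝ) * s ^ 2 := by positivity
    have h9 : 0 ≤ (s : ℝ) ^ 2 := by positivity
    nlinarith
  have hcount' : (s : ℝ) ^ 2 ≤ N 0 + N 1 + N 2 + f.natDegree := by exact_mod_cast hcount
  have habs : ∀ c, (c = 0 ∨ c = 1 ∨ c = 2) → ‖((N c : ℂ) - s ^ 2 / 3)‖ ≤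
      (7 * f.natDegree + 6) * s := by
    intro c hc
    have hd : (0 : ℝ) ≤ f.natDegree := Nat.cast_nonneg _
    have hs1 : (1 : ℝ) ≤ s := by
      have : 1 ≤ s := by omega
      exact_mod_cast this
    have h8 : (f.natDegree : ℝ) ≤ f.natDegree * s := le_mul_of_one_le_right hd hs1
    have : ((N c : ℂ) - s ^ 2 / 3) = (((N c : ℝ) - s ^ 2 / 3 : ℝ) : ℂ) := by push_cast; rfl
    rw [this, Complex.norm_real, Real.norm_eq_abs, abs_le]
    have a0 := hup 0
    have a1 := hup 1
    have a2 := hup 2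
    constructor
    · rcases hc with rfl | rfl | rfl <;> nlinarith
    · have := hup c
      nlinarith
  have hfin : ∑ x, ψ (u x) = ((N 0 : ℂ) - s ^ 2 / 3) + ((N 1 : ℂ) - s ^ 2 / 3) * w +
      ((N 2 : ℂ) - s ^ 2 / 3) * w ^ 2 := by
    rw [hsum]
    linear_combination ((s : ℂ) ^ 2 / 3) * hws
  rw [hfin]
  refine (norm_add₃_le).trans ?_
  rw [norm_mul, norm_mul, norm_pow, hwn]
  have a0 := habs 0 (by simp)
  have a1 := habs 1 (by simp)
  have a2 := habs 2 (by simp)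
  linarith

theorem norm_sum_monicPrimes_le_of_extension {F k K : Type*} [Field F] [Fintype F] [Field k]
    [Fintype k] [Field K] [Fintype K] [Algebra F K] (hF : Fintype.card F % 6 = 1) {P : F[X]}
    (hP : P.Monic) (hPi : Irreducible P) (π : F[X] →+* k) (ι : k →+* K) {θ : K}
    (hι : ∀ g, ι (π g) = aeval θ g) (hθ : aeval θ P = 0)
    (hk : Fintype.card k = Fintype.card F ^ P.natDegree)
    {ψ : MulChar k ℂ} (hψ3 : ψ ^ 3 = 1) (hψ1 : ψ ≠ 1) {m : ℕ} (hm : m ≠ 0)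
    (hK : Module.finrank F K = 2 * m) :
    ‖∑ Q ∈ monicPrimes F (2 * m), if Q.natDegree ∣ 2 * m ∧ 2 * m ≠ 0 then
      (Q.natDegree : ℂ) * ψ (π Q) ^ (2 * m / Q.natDegree) else 0‖ ≤
      (21 * P.natDegree + 18) * (Fintype.card F : ℝ) ^ m := by
  have hmin : minpoly F θ = P := (minpoly.eq_of_irreducible_of_monic hPi hθ hP).symm
  have h1 := sum_monicPrimes_eq_sum_minpoly
    (ψ.toMonoidHom.comp (π : F[X] →* k)) hK
  refine (congrArg norm h1).trans_le ?_
  obtain ⟨t, ht⟩ : ∃ t, Fintype.card F = 6 * t + 1 := ⟨Fintype.card F / 6, by omega⟩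
  have ht0 : t ≠ 0 := by
    rintro rfl
    have := Fintype.one_lt_card (α := F)
    omega
  have hgeom : ∀ n, 3 * ((∑ i ∈ Finset.range n, Fintype.card F ^ i) * (2 * t)) + 1 =
      Fintype.card F ^ n := by
    intro n
    rw [ht, ← geom_sum_mul_add]
    ring
  have hcK : Fintype.card K = Fintype.card F ^ (2 * m) := by
    rw [← hK, Module.card_eq_pow_finrank (K := F)]
  have hroot : (P.map (algebraMap F K)).IsRoot θ := by
    rw [IsRoot, eval_map_algebraMap, hθ]
  obtain ⟨h, hh⟩ := dvd_iff_isRoot.2 hroot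
  have hhθ : h.eval θ ≠ 0 := by
    have h2 := (PerfectField.separable_of_irreducible hPi).aeval_derivative_ne_zero hθ
    rw [← eval_map_algebraMap, ← derivative_map, hh] at h2
    intro h0
    simp [h0] at h2
  have key := norm_sum_cubic_mulChar_le ι hψ3 hψ1
    (fun x => π (minpoly F x ^ (2 * m / (minpoly F x).natDegree))) _ h θ hh hhθ
    (s := Fintype.card F ^ m)
    (A := (∑ i ∈ Finset.range (2 * m), Fintype.card F ^ i) * (2 * t))
    (b := (∑ i ∈ Finset.range P.natDegree, Fintype.card F ^ i) * (2 * t))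
    (by rw [hk, hgeom]) (by rw [hcK, ← pow_mul, mul_comm]) (by rw [hcK, hgeom])
    (by
      calc 3 ≤ Fintype.card F := by omega
        _ ≤ _ := Nat.le_self_pow hm _)
    (fun x => by
      have h2 := aeval_minpoly_pow_eq x θ hK (even_two_mul t)
      rw [hmin] at h2
      rw [hι, eval_map_algebraMap, ← h2, map_pow])
  rw [natDegree_map] at key
  exact_mod_cast key

theorem norm_sum_monicPrimes_le {F : Type*} [Field F] [Fintype F] (hF : Fintype.card F % 6 = 1)
    {P : F[X]} (hP : P.Monic) (hPi : Irreducible P)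
    {ψ : MulChar (F[X] ⧸ Ideal.span {P}) ℂ} (hψ3 : ψ ^ 3 = 1) (hψ1 : ψ ≠ 1) {m : ℕ} (hm : m ≠ 0)
    (hd : P.natDegree ∣ m) :
    ‖∑ Q ∈ monicPrimes F (2 * m), if Q.natDegree ∣ 2 * m ∧ 2 * m ≠ 0 then
      (Q.natDegree : ℂ) * ψ (Ideal.Quotient.mk (Ideal.span {P}) Q) ^ (2 * m / Q.natDegree)
      else 0‖ ≤ (21 * P.natDegree + 18) * (Fintype.card F : ℝ) ^ m := by
  obtain ⟨p, hp⟩ := CharP.exists F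
  have : Fact p.Prime := ⟨CharP.char_is_prime F p⟩
  have : NeZero (2 * m) := ⟨by omega⟩
  have := Fintype.ofFinite (FiniteField.Extension F p (2 * m))
  have hfin : Module.finrank F (FiniteField.Extension F p (2 * m)) = 2 * m :=
    FiniteField.finrank_extension F p (2 * m)
  have : Fact (Irreducible P) := ⟨hPi⟩
  have hmax : (Ideal.span {P}).IsMaximal := PrincipalIdealRing.isMaximal_of_irreducible hPi
  have hfr : Module.finrank F (AdjoinRoot P) = P.natDegree := finrank_quotient_span_eq_natDegree
  obtain ⟨φ⟩ := FiniteField.nonempty_algHom_of_finrank_dvd (F := F) (K := AdjoinRoot P)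
    (L := FiniteField.Extension F p (2 * m)) (by
      rw [hfr, hfin]
      exact hd.mul_left 2)
  have : Module.Finite F (AdjoinRoot P) := hP.finite_adjoinRoot
  have : Finite (AdjoinRoot P) := Module.finite_of_finite F
  have : Finite (F[X] ⧸ Ideal.span {P}) := this
  have := Fintype.ofFinite (F[X] ⧸ Ideal.span {P})
  let _ : Field (F[X] ⧸ Ideal.span {P}) := Ideal.Quotient.field _
  refine norm_sum_monicPrimes_le_of_extension hF hP hPi (Ideal.Quotient.mk (Ideal.span {P}))
    (φ : AdjoinRoot P →+* FiniteField.Extension F p (2 * m)) (θ := φ (AdjoinRoot.root P)) ?_ ?_ ?_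
    hψ3 hψ1 hm hfin
  · intro g
    rw [aeval_algHom_apply, AdjoinRoot.aeval_eq]
    rfl
  · rw [aeval_algHom_apply]
    simp
  · rw [← Nat.card_eq_fintype_card, ← Nat.card_eq_fintype_card]
    have := Module.natCard_eq_pow_finrank (K := F) (V := AdjoinRoot P)
    rw [hfr] at this
    exact this

/-- The twist of `χ` by the unramified character `f ↦ ζ ^ deg f`. -/
noncomputable def degreeTwist {F : Type*} [Field F] (χ : F[X] →* ℂ) (h0 : χ 0 = 0) (ζ : ℂ) :
    F[X] →* ℂ where
  toFun f := χ f * ζ ^ f.natDegree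
  map_one' := by simp
  map_mul' f g := by
    rcases eq_or_ne f 0 with rfl | hf
    · simp [h0]
    rcases eq_or_ne g 0 with rfl | hg
    · simp [h0]
    rw [map_mul, natDegree_mul hf hg]
    ring

theorem degreeTwist_apply {F : Type*} [Field F] (χ : F[X] →* ℂ) (h0 : χ 0 = 0) (ζ : ℂ)
    (f : F[X]) :
    degreeTwist χ h0 ζ f = χ f * ζ ^ f.natDegree := rfl

section
variable {F : Type*} [Field F] [Fintype F]

/-- The generating series of the sums of `χ` over monic polynomials of given degree. -/
noncomputable def lSeries (χ : F[X] →* ℂ) : PowerSeries ℂ :=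
  PowerSeries.mk fun n => ∑ f ∈ monicsOfDegree F n, χ f

/-- The generating series of `χ` is a polynomial of degree less than `d` whose inverse roots have
absolute value at most the square root of the cardinality of the base field. -/
def SatisfiesRH (χ : F[X] →* ℂ) (d : ℕ) : Prop :=
  ∃ (m : ℕ) (α : Fin m → ℂ), m < d ∧ (∀ i, ‖α i‖ ≤ √(Fintype.card F)) ∧
    lSeries χ = ∏ i, (1 - PowerSeries.C (α i) * PowerSeries.X)

theorem SatisfiesRH.degreeTwist {χ : F[X] →* ℂ} {d : ℕ} (h : SatisfiesRH χ d) (h0 : χ 0 = 0)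
    {ζ : ℂ} (hζ : ‖ζ‖ = 1) : SatisfiesRH (degreeTwist χ h0 ζ) d := by
  obtain ⟨m, α, hm, hα, hL⟩ := h
  refine ⟨m, fun i => α i * ζ, hm, fun i => by rw [norm_mul, hζ, mul_one]; exact hα i, ?_⟩
  have h1 : lSeries (_root_.degreeTwist χ h0 ζ) = PowerSeries.rescale ζ (lSeries χ) := by
    ext n
    rw [PowerSeries.coeff_rescale, lSeries, lSeries, PowerSeries.coeff_mk, PowerSeries.coeff_mk,
      Finset.mul_sum]
    refine Finset.sum_congr rfl fun f hf => ?_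
    rw [degreeTwist_apply, (mem_monicsOfDegree.1 hf).2, mul_comm]
  rw [h1, hL, map_prod]
  refine Finset.prod_congr rfl fun i _ => ?_
  ext n
  rw [PowerSeries.coeff_rescale, map_sub, map_sub, PowerSeries.coeff_one, PowerSeries.coeff_C_mul,
    PowerSeries.coeff_C_mul, PowerSeries.coeff_X]
  split_ifs <;> simp_all
  ring

theorem sum_pow_add_sum_monicPrimes_eq_zero {χ : F[X] →* ℂ} {m : ℕ} {α : Fin m → ℂ}
    (hL : lSeries χ = ∏ i, (1 - PowerSeries.C (α i) * PowerSeries.X)) {n : ℕ} (hn : n ≠ 0) :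
    ∑ i, α i ^ n + ∑ Q ∈ monicPrimes F n,
      (if Q.natDegree ∣ n ∧ n ≠ 0 then (Q.natDegree : ℂ) * χ Q ^ (n / Q.natDegree) else 0) = 0 := by
  have h1 := (PowerSeries.IsNegLogDeriv.prod Finset.univ fun i _ =>
    PowerSeries.IsNegLogDeriv.one_sub (α i) one_ne_zero).mul
    (PowerSeries.IsNegLogDeriv.prod (monicPrimes F n) fun Q hQ =>
      PowerSeries.IsNegLogDeriv.one_sub (χ Q) (mem_monicPrimes.1 hQ).2.1.natDegree_pos.ne')
  simp only [pow_one] at h1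
  rw [← hL] at h1
  have h2 := h1.coeff_eq_zero hn
    (by rw [lSeries, coeff_mul_prod_one_sub χ (Nat.zero_le n), if_pos rfl])
    (fun k hk1 hk => by rw [lSeries, coeff_mul_prod_one_sub χ hk, if_neg (by omega)])
  rw [map_add, map_sum, map_sum] at h2
  simp only [PowerSeries.coeff_mk] at h2
  simpa [hn] using h2

theorem satisfiesRH_of_mulChar (hF : Fintype.card F % 6 = 1) {P : F[X]} (hP : P.Monic)
    (hPi : Irreducible P) {ψ : MulChar (F[X] ⧸ Ideal.span {P}) ℂ} (hψ3 : ψ ^ 3 = 1)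
    (hψ1 : ψ ≠ 1) : SatisfiesRH
      (ψ.toMonoidHom.comp (Ideal.Quotient.mk (Ideal.span {P}) : F[X] →* _)) P.natDegree := by
  set χ : F[X] →* ℂ := ψ.toMonoidHom.comp (Ideal.Quotient.mk (Ideal.span {P}) : F[X] →* _)
  have hd : 0 < P.natDegree := hPi.natDegree_pos
  set p : ℂ[X] := ∑ n ∈ Finset.range P.natDegree, C (∑ f ∈ monicsOfDegree F n, χ f) * X ^ n with hp
  have hcoeff : ∀ n, p.coeff n = ∑ f ∈ monicsOfDegree F n, χ f := by
    intro n
    rw [hp, finsetSum_coeff]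
    simp only [coeff_C_mul_X_pow]
    rw [Finset.sum_ite_eq, ite_eq_left_iff]
    intro hn
    rw [Finset.mem_range, not_lt] at hn
    exact (sum_mulChar_monicsOfDegree_eq_zero hP hψ1 hn).symm
  have hpL : lSeries χ = (p : PowerSeries ℂ) := by
    ext n
    rw [lSeries, PowerSeries.coeff_mk, coeff_coe, hcoeff]
  have hp0 : p.coeff 0 = 1 := by
    have : monicsOfDegree F 0 = {1} := by
      ext f
      rw [mem_monicsOfDegree, Finset.mem_singleton]
      constructor
      · rintro ⟨h1, h2⟩
        exact h1.natDegree_eq_zero.1 h2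
      · rintro rfl
        exact ⟨monic_one, natDegree_one⟩
    rw [hcoeff, this, Finset.sum_singleton, map_one]
  have hdeg : p.natDegree < P.natDegree := by
    rw [natDegree_lt_iff_degree_lt (by rintro h; simp [h] at hp0)]
    rw [hp]
    refine (degree_sum_le _ _).trans_lt ((Finset.sup_lt_iff (WithBot.bot_lt_coe _)).2 ?_)
    intro n hn
    exact (degree_C_mul_X_pow_le _ _).trans_lt (by exact_mod_cast Finset.mem_range.1 hn)
  obtain ⟨l, hl⟩ := Quot.exists_rep p.roots
  have hl' : (l : Multiset ℂ) = p.roots := hl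
  have hprod : lSeries χ = ∏ i : Fin l.length,
      (1 - PowerSeries.C ((l.get i)⁻¹) * PowerSeries.X) := by
    rw [hpL, eq_prod_one_sub_inv_roots p hp0, ← hl', Multiset.map_coe, Multiset.prod_coe]
    have h2 : (l.map fun r => 1 - C r⁻¹ * X).prod =
        ∏ i : Fin l.length, (1 - C ((l.get i)⁻¹) * X : ℂ[X]) := by
      have h3 := List.map_ofFn (f := l.get) (g := fun r => (1 - C r⁻¹ * X : ℂ[X]))
      rw [List.ofFn_get] at h3
      rw [h3, List.prod_ofFn]
      rfl
    rw [h2, ← coeToPowerSeries.ringHom_apply, map_prod]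
    simp
  refine ⟨l.length, fun i => (l.get i)⁻¹, ?_, fun i => ?_, hprod⟩
  · have : l.length = p.roots.card := by rw [← hl', Multiset.coe_card]
    rw [this]
    exact p.card_roots'.trans_lt hdeg
  · have hq : (0 : ℝ) < Fintype.card F := by exact_mod_cast Fintype.card_pos
    refine norm_le_of_norm_sum_pow_le (fun i => (l.get i)⁻¹) (C := 21 * P.natDegree + 18)
      (D := 2 * P.natDegree) (N := 1) (Real.sqrt_pos.2 hq) (by omega) ?_ i
    intro n hn
    have h1 := sum_pow_add_sum_monicPrimes_eq_zero hprod (n := 2 * (P.natDegree * n))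
      (by positivity)
    have h2 := norm_sum_monicPrimes_le hF hP hPi hψ3 hψ1 (m := P.natDegree * n) (by positivity)
      (dvd_mul_right _ _)
    have h3 : √(Fintype.card F : ℝ) ^ (2 * P.natDegree * n) =
        (Fintype.card F : ℝ) ^ (P.natDegree * n) := by
      rw [mul_assoc, pow_mul, Real.sq_sqrt hq.le]
    rw [h3, mul_assoc, eq_neg_of_add_eq_zero_left h1, norm_neg]
    exact h2
end

section
/-- The weighted sum of the absolute values of the coefficients of degree at most `N`. -/
noncomputable def truncNorm (N : ℕ) (r : ℝ) (P : PowerSeries ℂ) : ℝ :=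
  ∑ n ∈ Finset.range (N + 1), ‖PowerSeries.coeff n P‖ * r ^ n

variable {N : ℕ} {r : ℝ}

theorem truncNorm_nonneg (hr : 0 ≤ r) (P : PowerSeries ℂ) : 0 ≤ truncNorm N r P :=
  Finset.sum_nonneg fun _ _ => by positivity

theorem norm_coeff_mul_pow_le_truncNorm (hr : 0 ≤ r) (P : PowerSeries ℂ) :
    ‖PowerSeries.coeff N P‖ * r ^ N ≤ truncNorm N r P :=
  Finset.single_le_sum (f := fun n => ‖PowerSeries.coeff n P‖ * r ^ n)
    (fun _ _ => by positivity) (Finset.self_mem_range_succ N)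

theorem truncNorm_add_le (hr : 0 ≤ r) (P Q : PowerSeries ℂ) :
    truncNorm N r (P + Q) ≤ truncNorm N r P + truncNorm N r Q := by
  simp only [truncNorm, ← Finset.sum_add_distrib, ← add_mul, map_add]
  gcongr
  exact norm_add_le _ _

theorem truncNorm_C_mul_X_pow_le (hr : 0 ≤ r) (c : ℂ) (k : ℕ) :
    truncNorm N r (PowerSeries.C c * PowerSeries.X ^ k) ≤ ‖c‖ * r ^ k := by
  have h : ∀ n, ‖PowerSeries.coeff n (PowerSeries.C c * PowerSeries.X ^ k)‖ * r ^ n =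
      if n = k then ‖c‖ * r ^ k else 0 := by
    intro n
    rw [PowerSeries.coeff_C_mul, PowerSeries.coeff_X_pow]
    split_ifs with h
    · simp [h]
    · simp
  simp only [truncNorm, h, Finset.sum_ite_eq']
  split_ifs
  · exact le_rfl
  · positivity

theorem truncNorm_one (N : ℕ) (r : ℝ) : truncNorm N r 1 = 1 := by
  simp only [truncNorm, PowerSeries.coeff_one, apply_ite norm, norm_one, norm_zero, ite_mul,
    zero_mul, Finset.sum_ite_eq']
  simp

theorem truncNorm_mul_le (hr : 0 ≤ r) (P Q : PowerSeries ℂ) :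
    truncNorm N r (P * Q) ≤ truncNorm N r P * truncNorm N r Q := by
  simp only [truncNorm]
  rw [Finset.sum_mul_sum, ← Finset.sum_product']
  have h1 : ∀ n ∈ Finset.range (N + 1), ‖PowerSeries.coeff n (P * Q)‖ * r ^ n ≤
      ∑ x ∈ (Finset.range (N + 1) ×ˢ Finset.range (N + 1)) with x.1 + x.2 = n,
        ‖PowerSeries.coeff x.1 P‖ * r ^ x.1 * (‖PowerSeries.coeff x.2 Q‖ * r ^ x.2) := by
    intro n hn
    have h2 : ((Finset.range (N + 1) ×ˢ Finset.range (N + 1)).filter fun x => x.1 + x.2 = n) =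
        Finset.HasAntidiagonal.antidiagonal n := by
      ext x
      simp only [Finset.mem_filter, Finset.mem_product, Finset.mem_range,
        Finset.HasAntidiagonal.mem_antidiagonal] at hn ⊢
      omega
    rw [h2, PowerSeries.coeff_mul]
    refine (mul_le_mul_of_nonneg_right (norm_sum_le _ _) (by positivity)).trans_eq ?_
    rw [Finset.sum_mul]
    refine Finset.sum_congr rfl fun x hx => ?_
    rw [← Finset.HasAntidiagonal.mem_antidiagonal.1 hx, norm_mul, pow_add]
    ring
  refine (Finset.sum_le_sum h1).trans ?_
  rw [← Finset.sum_biUnion]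
  · refine Finset.sum_le_sum_of_subset_of_nonneg ?_ fun _ _ _ => by positivity
    exact Finset.biUnion_subset.2 fun _ _ => Finset.filter_subset _ _
  · intro i _ j _ hij
    exact Finset.disjoint_filter.2 fun x _ h1 h2 => hij (h1.symm.trans h2)

theorem truncNorm_prod_le {ι : Type*} (hr : 0 ≤ r) (s : Finset ι) (P : ι → PowerSeries ℂ) :
    truncNorm N r (∏ i ∈ s, P i) ≤ ∏ i ∈ s, truncNorm N r (P i) := by
  classical
  induction s using Finset.induction_on with
  | empty => simp [truncNorm_one]
  | insert i s hi ih =>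
    rw [Finset.prod_insert hi, Finset.prod_insert hi]
    exact (truncNorm_mul_le hr _ _).trans
      (mul_le_mul_of_nonneg_left ih (truncNorm_nonneg hr _))

theorem truncNorm_prod_one_sub_le {m : ℕ} (hr : 0 ≤ r) (α : Fin m → ℂ)
    (hα : ∀ i, ‖α i‖ * r ≤ 1) :
    truncNorm N r (∏ i, (1 - PowerSeries.C (α i) * PowerSeries.X)) ≤ 2 ^ m := by
  refine (truncNorm_prod_le hr _ _).trans ?_
  refine (Finset.prod_le_prod (g := fun _ => (2 : ℝ)) (fun i _ => truncNorm_nonneg hr _)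
    fun i _ => ?_).trans_eq (by simp)
  have : (1 - PowerSeries.C (α i) * PowerSeries.X : PowerSeries ℂ) =
      1 + PowerSeries.C (-α i) * PowerSeries.X ^ 1 := by
    rw [map_neg]
    ring
  rw [this]
  refine (truncNorm_add_le hr _ _).trans ?_
  have h1 := truncNorm_C_mul_X_pow_le (N := N) hr (-α i) 1
  rw [norm_neg, pow_one r] at h1
  rw [truncNorm_one]
  linarith [hα i]

theorem truncNorm_cubic_euler_factor_le (hr : 0 ≤ r) (hr1 : r ≤ 1) {a b : ℂ} (ha : ‖a‖ ≤ 1)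
    (hb : ‖b‖ ≤ 1) (k : ℕ) :
    truncNorm N r ((1 + PowerSeries.C (a + b) * PowerSeries.X ^ k) *
      (1 - PowerSeries.C a * PowerSeries.X ^ k) * (1 - PowerSeries.C b * PowerSeries.X ^ k)) ≤
    1 + 7 * r ^ (2 * k) := by
  have h : ((1 + PowerSeries.C (a + b) * PowerSeries.X ^ k) *
      (1 - PowerSeries.C a * PowerSeries.X ^ k) *
      (1 - PowerSeries.C b * PowerSeries.X ^ k) : PowerSeries ℂ) =
      1 + PowerSeries.C (a * b - (a + b) ^ 2) * PowerSeries.X ^ (2 * k) +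
        PowerSeries.C (a * b * (a + b)) * PowerSeries.X ^ (3 * k) := by
    simp only [map_add, map_sub, map_mul, map_pow]
    ring
  rw [h]
  refine (truncNorm_add_le hr _ _).trans ((add_le_add (truncNorm_add_le hr _ _) le_rfl).trans ?_)
  rw [truncNorm_one]
  have hab : ‖a * b‖ ≤ 1 := by
    rw [norm_mul]
    exact mul_le_one₀ ha (norm_nonneg _) hb
  have hs : ‖a + b‖ ≤ 2 := (norm_add_le _ _).trans (by linarith)
  have h5 : ‖a * b - (a + b) ^ 2‖ ≤ 5 := by
    refine (norm_sub_le _ _).trans ?_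
    rw [norm_pow]
    nlinarith [norm_nonneg (a + b)]
  have h2 : ‖a * b * (a + b)‖ ≤ 2 := by
    rw [norm_mul]
    nlinarith [norm_nonneg (a + b), norm_nonneg (a * b)]
  have h3 : r ^ (3 * k) ≤ r ^ (2 * k) := pow_le_pow_of_le_one hr hr1 (by omega)
  have h4 : 0 ≤ r ^ (3 * k) := by positivity
  have h6 : 0 ≤ r ^ (2 * k) := by positivity
  have e1 := truncNorm_C_mul_X_pow_le (N := N) hr (a * b - (a + b) ^ 2) (2 * k)
  have e2 := truncNorm_C_mul_X_pow_le (N := N) hr (a * b * (a + b)) (3 * k)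
  have e3 : ‖a * b - (a + b) ^ 2‖ * r ^ (2 * k) ≤ 5 * r ^ (2 * k) := by gcongr
  have e4 : ‖a * b * (a + b)‖ * r ^ (3 * k) ≤ 2 * r ^ (2 * k) := by gcongr
  linarith

theorem truncNorm_one_sub_mul_one_sub_le (hr : 0 ≤ r) (hr1 : r ≤ 1) {a b : ℂ} (ha : ‖a‖ ≤ 1)
    (hb : ‖b‖ ≤ 1) (k : ℕ) :
    truncNorm N r ((1 - PowerSeries.C a * PowerSeries.X ^ k) *
      (1 - PowerSeries.C b * PowerSeries.X ^ k)) ≤ 4 := by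
  have key : ∀ c : ℂ, ‖c‖ ≤ 1 →
      truncNorm N r (1 - PowerSeries.C c * PowerSeries.X ^ k) ≤ 2 := by
    intro c hc
    have : (1 - PowerSeries.C c * PowerSeries.X ^ k : PowerSeries ℂ) =
        1 + PowerSeries.C (-c) * PowerSeries.X ^ k := by
      rw [map_neg]
      ring
    rw [this]
    refine (truncNorm_add_le hr _ _).trans ?_
    have h1 := truncNorm_C_mul_X_pow_le (N := N) hr (-c) k
    rw [norm_neg] at h1
    have h2 : ‖c‖ * r ^ k ≤ 1 := mul_le_one₀ hc (by positivity) (pow_le_one₀ hr hr1)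
    rw [truncNorm_one]
    linarith
  calc _ ≤ _ := truncNorm_mul_le hr _ _
    _ ≤ 2 * 2 := mul_le_mul (key a ha) (key b hb) (truncNorm_nonneg hr _) zero_le_two
    _ = 4 := by norm_num

theorem coeff_mul_eq_of_coeff_eq_one {U : PowerSeries ℂ}
    (hU : ∀ n ≤ N, PowerSeries.coeff n U = if n = 0 then 1 else 0) (P : PowerSeries ℂ) {n : ℕ}
    (hn : n ≤ N) : PowerSeries.coeff n (P * U) = PowerSeries.coeff n P := by
  rw [PowerSeries.coeff_mul, Finset.sum_eq_single (n, 0)]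
  · rw [hU 0 (Nat.zero_le _), if_pos rfl, mul_one]
  · rintro ⟨i, j⟩ hij hne
    rw [Finset.HasAntidiagonal.mem_antidiagonal] at hij
    have hj : j ≠ 0 := by
      rintro rfl
      exact hne (by simp_all)
    rw [hU j (by simp only at hij; omega), if_neg hj, mul_zero]
  · simp
end

section
variable {F : Type*} [Field F]

theorem cubeFree_one : (1 : F[X]).CubeFree := fun _ _ hPi h =>
  hPi.not_isUnit (isUnit_of_dvd_one ((dvd_pow_self _ three_ne_zero).trans h))

theorem cubeFree_pow_mul {Q D : F[X]} (hQ : Q.Monic) (hQi : Irreducible Q) (hD : D.CubeFree)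
    (hQD : ¬ Q ∣ D) {e : ℕ} (he : e < 3) : (Q ^ e * D).CubeFree := by
  intro R hR hRi h
  by_cases hRQ : R = Q
  · subst hRQ
    obtain ⟨t, ht⟩ : ∃ t, 3 = e + (t + 1) := ⟨2 - e, by omega⟩
    rw [ht, pow_add, mul_dvd_mul_iff_left (pow_ne_zero _ hR.ne_zero)] at h
    exact hQD ((dvd_pow_self _ t.succ_ne_zero).trans h)
  · refine hD R hR hRi (IsCoprime.dvd_of_dvd_mul_left (IsCoprime.pow ?_) h)
    rw [hRi.coprime_iff_not_dvd, hR.dvd_irreducible_iff_eq hRi hQ hQi]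
    exact hRQ

theorem eq_of_pow_mul_eq_pow_mul {Q D D' : F[X]} (hQ : Q ≠ 0) (hD : ¬ Q ∣ D) (hD' : ¬ Q ∣ D')
    {e e' : ℕ} (h : Q ^ e * D = Q ^ e' * D') : e = e' ∧ D = D' := by
  have key : ∀ {A A' : F[X]} {i j : ℕ}, ¬ Q ∣ A → Q ^ i * A = Q ^ j * A' → j ≤ i := by
    intro A A' i j hA h
    by_contra! hij
    obtain ⟨t, rfl⟩ := Nat.exists_eq_add_of_lt hij
    rw [add_assoc, pow_add, mul_assoc] at h
    rw [mul_left_cancel₀ (pow_ne_zero _ hQ) h] at hA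
    exact hA ((dvd_pow_self _ t.succ_ne_zero).mul_right _)
  obtain rfl : e = e' := le_antisymm (key hD' h.symm) (key hD h)
  exact ⟨rfl, mul_left_cancel₀ (pow_ne_zero _ hQ) h⟩

variable [DecidableEq F]

theorem mem_toFinset_normalizedFactors {D Q : F[X]} (hD : D ≠ 0) :
    Q ∈ (normalizedFactors D).toFinset ↔ Q.Monic ∧ Irreducible Q ∧ Q ∣ D := by
  rw [Multiset.mem_toFinset, mem_normalizedFactors_iff' hD]
  constructor
  · rintro ⟨h1, h2, h3⟩
    exact ⟨h2 ▸ monic_normalize h1.ne_zero, h1, h3⟩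
  · rintro ⟨h1, h2, h3⟩
    exact ⟨h2, h1.normalize_eq_self, h3⟩

theorem natDegree_le_radDeg {D Q : F[X]} (hD : D ≠ 0) (hQ : Q.Monic) (hQi : Irreducible Q)
    (h : Q ∣ D) : Q.natDegree ≤ D.radDeg :=
  Finset.single_le_sum (f := fun Q : F[X] => Q.natDegree) (fun _ _ => Nat.zero_le _)
    ((mem_toFinset_normalizedFactors hD).2 ⟨hQ, hQi, h⟩)

theorem radDeg_one : (1 : F[X]).radDeg = 0 := by
  simp [radDeg]

theorem radDeg_pow_mul {Q D : F[X]} (hQ : Q.Monic) (hQi : Irreducible Q) (hD : D ≠ 0)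
    (hQD : ¬ Q ∣ D) {e : ℕ} (he : e ≠ 0) :
    (Q ^ e * D).radDeg = Q.natDegree + D.radDeg := by
  have h0 : Q ^ e * D ≠ 0 := mul_ne_zero (pow_ne_zero _ hQ.ne_zero) hD
  have h1 : (normalizedFactors (Q ^ e * D)).toFinset =
      insert Q (normalizedFactors D).toFinset := by
    ext R
    rw [mem_toFinset_normalizedFactors h0, Finset.mem_insert, mem_toFinset_normalizedFactors hD]
    constructor
    · rintro ⟨h1, h2, h3⟩
      rcases h2.prime.dvd_or_dvd h3 with h | h
      · exact .inl ((h1.dvd_irreducible_iff_eq h2 hQ hQi).1 (h2.prime.dvd_of_dvd_pow h))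
      · exact .inr ⟨h1, h2, h⟩
    · rintro (rfl | ⟨h1, h2, h3⟩)
      · exact ⟨hQ, hQi, (dvd_pow_self _ he).mul_right _⟩
      · exact ⟨h1, h2, h3.mul_left _⟩
  rw [radDeg, h1, Finset.sum_insert, radDeg]
  rw [mem_toFinset_normalizedFactors hD]
  exact fun h => hQD h.2.2

/-- The Euler product attached to the cube-free polynomials supported on `T`. -/
theorem exists_finset_cubeFree_prod_eq (T : Finset F[X])
    (hT : ∀ Q ∈ T, Q.Monic ∧ Irreducible Q) :
    ∃ S : Finset F[X], (∀ D, D ∈ S ↔ D.Monic ∧ D.CubeFree ∧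
      ∀ Q, Q.Monic → Irreducible Q → Q ∣ D → Q ∈ T) ∧
      ∀ χ : F[X] →* ℂ, ∏ Q ∈ T, (1 + PowerSeries.C (χ Q + χ Q ^ 2) * PowerSeries.X ^ Q.natDegree) =
        ∑ D ∈ S, PowerSeries.C (χ D) * PowerSeries.X ^ D.radDeg := by
  induction T using Finset.induction_on with
  | empty =>
    refine ⟨{1}, fun D => ?_, fun χ => ?_⟩
    · rw [Finset.mem_singleton]
      constructor
      · rintro rfl
        exact ⟨monic_one, cubeFree_one, fun Q _ hQi h =>
          absurd (isUnit_of_dvd_one h) hQi.not_isUnit⟩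
      · rintro ⟨h1, h2, h3⟩
        by_contra hne
        have hu : ¬ IsUnit D := fun h => hne (h1.eq_one_of_isUnit h)
        obtain ⟨Q, hQm, hQi, hQd⟩ := exists_monic_irreducible_factor D hu
        exact absurd (h3 Q hQm hQi hQd) (Finset.notMem_empty _)
    · simp [radDeg_one]
  | insert Q T hQT ih =>
    obtain ⟨hQ, hQi⟩ := hT Q (Finset.mem_insert_self _ _)
    obtain ⟨S, hS, hprod⟩ := ih fun R hR => hT R (Finset.mem_insert_of_mem hR)
    have hQS : ∀ D ∈ S, ¬ Q ∣ D := fun D hD h => hQT (((hS D).1 hD).2.2 Q hQ hQi h)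
    refine ⟨(Finset.range 3 ×ˢ S).image fun x => Q ^ x.1 * x.2, fun D => ?_, fun χ => ?_⟩
    · rw [Finset.mem_image]
      constructor
      · rintro ⟨⟨e, D⟩, hx, rfl⟩
        rw [Finset.mem_product, Finset.mem_range] at hx
        obtain ⟨h1, h2, h3⟩ := (hS D).1 hx.2
        refine ⟨(hQ.pow e).mul h1, cubeFree_pow_mul hQ hQi h2 (hQS D hx.2) hx.1, ?_⟩
        intro R hR hRi hd
        rcases hRi.prime.dvd_or_dvd hd with h | h
        · rw [(hR.dvd_irreducible_iff_eq hRi hQ hQi).1 (hRi.prime.dvd_of_dvd_pow h)]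
          exact Finset.mem_insert_self _ _
        · exact Finset.mem_insert_of_mem (h3 R hR hRi h)
      · rintro ⟨h1, h2, h3⟩
        obtain ⟨e, D', hD', rfl⟩ := WfDvdMonoid.max_power_factor h1.ne_zero hQi
        have he : e < 3 := by
          by_contra! he
          exact h2 Q hQ hQi ((pow_dvd_pow _ he).mul_right _)
        refine ⟨(e, D'), ?_, rfl⟩
        rw [Finset.mem_product, Finset.mem_range, hS]
        refine ⟨he, (hQ.pow e).of_mul_monic_left h1,
          fun R hR hRi h => h2 R hR hRi (h.mul_left _), fun R hR hRi h => ?_⟩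
        refine Finset.mem_of_mem_insert_of_ne (h3 R hR hRi (h.mul_left _)) ?_
        rintro rfl
        exact hD' h
    · rw [Finset.prod_insert hQT, hprod, Finset.sum_image, Finset.sum_product, Finset.mul_sum,
        Finset.sum_comm]
      · refine Finset.sum_congr rfl fun D hD => ?_
        have hD0 : D ≠ 0 := ((hS D).1 hD).1.ne_zero
        rw [Finset.sum_range_succ, Finset.sum_range_succ, Finset.sum_range_one, pow_zero, one_mul,
          radDeg_pow_mul hQ hQi hD0 (hQS D hD) one_ne_zero,
          radDeg_pow_mul hQ hQi hD0 (hQS D hD) two_ne_zero]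
        simp only [map_mul, map_pow, map_add, pow_one, pow_add]
        ring
      · rintro ⟨e, D⟩ hx ⟨e', D'⟩ hx' h
        rw [Finset.mem_coe, Finset.mem_product] at hx hx'
        obtain ⟨rfl, rfl⟩ := eq_of_pow_mul_eq_pow_mul hQ.ne_zero (hQS D hx.2) (hQS D' hx'.2) h
        rfl
end

section
variable {F : Type*} [Field F] [Fintype F]

theorem sum_monicPrimes_pow_natDegree_le {x : ℝ} (hx : 0 ≤ x)
    (hx1 : Fintype.card F * x < 1) (N : ℕ) :
    ∑ Q ∈ monicPrimes F N, x ^ Q.natDegree ≤ (1 - Fintype.card F * x)⁻¹ := by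
  classical
  have hmem : ∀ Q ∈ monicPrimes F N, Q.natDegree ∈ Finset.range (N + 1) := fun Q hQ =>
    Finset.mem_range.2 (Nat.lt_succ_of_le (mem_monicPrimes.1 hQ).2.2)
  have h0 : 0 ≤ Fintype.card F * x := by positivity
  rw [← Finset.sum_fiberwise_of_maps_to hmem, ← tsum_geometric_of_lt_one h0 hx1]
  refine le_trans (Finset.sum_le_sum fun n _ => ?_)
    ((summable_geometric_of_lt_one h0 hx1).sum_le_tsum (Finset.range (N + 1))
      fun _ _ => by positivity)
  have h1 : ∀ Q ∈ (monicPrimes F N).filter fun Q => Q.natDegree = n, x ^ Q.natDegree = x ^ n :=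
    fun Q hQ => by rw [(Finset.mem_filter.1 hQ).2]
  rw [Finset.sum_congr rfl h1, Finset.sum_const, nsmul_eq_mul, mul_pow]
  gcongr
  rw [← Nat.cast_pow, ← card_monicsOfDegree]
  refine Nat.cast_le.2 (Finset.card_le_card fun Q hQ => ?_)
  rw [Finset.mem_filter, mem_monicPrimes] at hQ
  exact mem_monicsOfDegree.2 ⟨hQ.1.1, hQ.2⟩

theorem SatisfiesRH.truncNorm_lSeries_le {χ : F[X] →* ℂ} {d N : ℕ} (h : SatisfiesRH χ d) {r : ℝ}
    (hr : 0 ≤ r) (hq : √(Fintype.card F) * r ≤ 1) : truncNorm N r (lSeries χ) ≤ 2 ^ d := by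
  obtain ⟨m, α, hm, hα, hL⟩ := h
  rw [hL]
  refine (truncNorm_prod_one_sub_le hr α fun i => ?_).trans
    (pow_le_pow_right₀ one_le_two hm.le)
  exact (mul_le_mul_of_nonneg_right (hα i) hr).trans hq

variable [DecidableEq F]

theorem norm_coeff_cubic_euler_product_le {B : F[X]} (hB : B ≠ 0) {χ : F[X] →* ℂ} {d N : ℕ}
    (h1 : SatisfiesRH χ d) (h2 : SatisfiesRH (χ ^ 2) d) (hχ : ∀ f, ‖χ f‖ ≤ 1) {r : ℝ}
    (hr : 0 ≤ r) (hr1 : r ≤ 1) (hq : √(Fintype.card F) * r ≤ 1)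
    (hq2 : Fintype.card F * r ^ 2 < 1) [DecidablePred fun Q : F[X] => ¬ Q ∣ B] :
    ‖PowerSeries.coeff N (∏ Q ∈ (monicPrimes F N).filter fun Q => ¬ Q ∣ B,
      (1 + PowerSeries.C (χ Q + χ Q ^ 2) * PowerSeries.X ^ Q.natDegree))‖ * r ^ N ≤
    4 ^ (normalizedFactors B).toFinset.card *
      Real.exp (7 * (1 - Fintype.card F * r ^ 2)⁻¹) * 4 ^ d := by
  classical
  set E := ∏ Q ∈ (monicPrimes F N).filter fun Q => ¬ Q ∣ B,
      (1 + PowerSeries.C (χ Q + χ Q ^ 2) * PowerSeries.X ^ Q.natDegree : PowerSeries ℂ)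
  set G₁ := ∏ Q ∈ monicPrimes F N,
    (1 - PowerSeries.C (χ Q) * PowerSeries.X ^ Q.natDegree : PowerSeries ℂ)
  set G₂ := ∏ Q ∈ monicPrimes F N,
    (1 - PowerSeries.C ((χ ^ 2) Q) * PowerSeries.X ^ Q.natDegree : PowerSeries ℂ)
  have hcoeff : PowerSeries.coeff N E =
      PowerSeries.coeff N ((E * G₁ * G₂) * (lSeries χ * lSeries (χ ^ 2))) := by
    have e : (E * G₁ * G₂) * (lSeries χ * lSeries (χ ^ 2)) =
        (E * (lSeries χ * G₁)) * (lSeries (χ ^ 2) * G₂) := by ring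
    have u₁ : ∀ n ≤ N, PowerSeries.coeff n (lSeries χ * G₁) = if n = 0 then 1 else 0 :=
      fun n hn => coeff_mul_prod_one_sub χ hn
    have u₂ : ∀ n ≤ N, PowerSeries.coeff n (lSeries (χ ^ 2) * G₂) = if n = 0 then 1 else 0 :=
      fun n hn => coeff_mul_prod_one_sub (χ ^ 2) hn
    rw [e, coeff_mul_eq_of_coeff_eq_one u₂ _ le_rfl, coeff_mul_eq_of_coeff_eq_one u₁ _ le_rfl]
  have hprod : E * G₁ * G₂ = ∏ Q ∈ monicPrimes F N,
      ((if ¬ Q ∣ B then 1 + PowerSeries.C (χ Q + χ Q ^ 2) * PowerSeries.X ^ Q.natDegree else 1) *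
        (1 - PowerSeries.C (χ Q) * PowerSeries.X ^ Q.natDegree) *
        (1 - PowerSeries.C ((χ ^ 2) Q) * PowerSeries.X ^ Q.natDegree)) := by
    rw [Finset.prod_mul_distrib, Finset.prod_mul_distrib, ← Finset.prod_filter]
  have hlocal : ∀ Q ∈ monicPrimes F N, truncNorm N r
      ((if ¬ Q ∣ B then 1 + PowerSeries.C (χ Q + χ Q ^ 2) * PowerSeries.X ^ Q.natDegree else 1) *
        (1 - PowerSeries.C (χ Q) * PowerSeries.X ^ Q.natDegree) *
        (1 - PowerSeries.C ((χ ^ 2) Q) * PowerSeries.X ^ Q.natDegree)) ≤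
      (if Q ∣ B then 4 else 1) * Real.exp (7 * (r ^ 2) ^ Q.natDegree) := by
    intro Q _
    have hχ2 : ‖χ Q ^ 2‖ ≤ 1 := by
      rw [norm_pow]
      exact pow_le_one₀ (norm_nonneg _) (hχ Q)
    rw [MonoidHom.pow_apply, ← pow_mul]
    by_cases hQ : Q ∣ B
    · rw [if_neg (not_not.2 hQ), if_pos hQ, one_mul]
      refine (truncNorm_one_sub_mul_one_sub_le hr hr1 (hχ Q) hχ2 _).trans ?_
      exact le_mul_of_one_le_right (by norm_num) (Real.one_le_exp (by positivity))
    · rw [if_pos hQ, if_neg hQ, one_mul]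
      refine (truncNorm_cubic_euler_factor_le hr hr1 (hχ Q) hχ2 _).trans ?_
      rw [add_comm]
      exact Real.add_one_le_exp _
  have hH : truncNorm N r (E * G₁ * G₂) ≤ 4 ^ (normalizedFactors B).toFinset.card *
      Real.exp (7 * (1 - Fintype.card F * r ^ 2)⁻¹) := by
    rw [hprod]
    refine (truncNorm_prod_le hr _ _).trans ((Finset.prod_le_prod
      (fun _ _ => truncNorm_nonneg hr _) hlocal).trans ?_)
    rw [Finset.prod_mul_distrib, ← Finset.prod_filter, Finset.prod_const, ← Real.exp_sum,
      ← Finset.mul_sum]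
    gcongr
    · norm_num
    · intro Q hQ
      rw [Finset.mem_filter, mem_monicPrimes] at hQ
      exact (mem_toFinset_normalizedFactors hB).2 ⟨hQ.1.1, hQ.1.2.1, hQ.2⟩
    · exact sum_monicPrimes_pow_natDegree_le (by positivity) hq2 N
  rw [hcoeff]
  refine (norm_coeff_mul_pow_le_truncNorm hr _).trans ((truncNorm_mul_le hr _ _).trans ?_)
  refine mul_le_mul hH ((truncNorm_mul_le hr _ _).trans ?_) (truncNorm_nonneg hr _)
    (by positivity)
  have h4 : (4 : ℝ) ^ d = 2 ^ d * 2 ^ d := by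
    rw [← mul_pow]
    norm_num
  rw [h4]
  exact mul_le_mul (h1.truncNorm_lSeries_le hr hq) (h2.truncNorm_lSeries_le hr hq)
    (truncNorm_nonneg hr _) (by positivity)

theorem sum_range_three_pow_eq {w : ℂ} (hw : IsPrimitiveRoot w 3) (n : ℕ) :
    ∑ j ∈ Finset.range 3, (w ^ j) ^ n = if 3 ∣ n then 3 else 0 := by
  have h1 : ∑ j ∈ Finset.range 3, (w ^ j) ^ n = 1 + w ^ n + (w ^ n) ^ 2 := by
    simp [Finset.sum_range_succ, ← pow_mul, mul_comm]
  rw [h1]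
  split_ifs with h
  · rw [(hw.pow_eq_one_iff_dvd n).2 h]
    norm_num
  · have h2 : w ^ n - 1 ≠ 0 := sub_ne_zero.2 fun h3 => h ((hw.pow_eq_one_iff_dvd n).1 h3)
    have h3 : (w ^ n) ^ 3 = 1 := by rw [← pow_mul, mul_comm, pow_mul, hw.pow_eq_one, one_pow]
    refine (mul_eq_zero.1 (?_ : (w ^ n - 1) * (1 + w ^ n + (w ^ n) ^ 2) = 0)).resolve_left h2
    linear_combination h3

theorem finsum_mem_cubicTwistFamily_eq {B : F[X]} {χ : F[X] →* ℂ} (h0 : χ 0 = 0)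
    {w : ℂ} (hw : IsPrimitiveRoot w 3) (N : ℕ) [DecidablePred fun Q : F[X] => ¬ Q ∣ B] :
    3 * ∑ᶠ D ∈ cubicTwistFamily B N, χ D =
      ∑ j ∈ Finset.range 3, PowerSeries.coeff N
        (∏ Q ∈ (monicPrimes F N).filter fun Q => ¬ Q ∣ B,
          (1 + PowerSeries.C (degreeTwist χ h0 (w ^ j) Q + degreeTwist χ h0 (w ^ j) Q ^ 2) *
            PowerSeries.X ^ Q.natDegree)) := by
  obtain ⟨S, hS, hprod⟩ := exists_finset_cubeFree_prod_eq
    ((monicPrimes F N).filter fun Q => ¬ Q ∣ B) fun Q hQ => by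
      rw [Finset.mem_filter, mem_monicPrimes] at hQ
      exact ⟨hQ.1.1, hQ.1.2.1⟩
  have hfam : cubicTwistFamily B N =
      ((S.filter fun D => D.radDeg = N ∧ 3 ∣ D.natDegree : Finset F[X]) : Set F[X]) := by
    ext D
    simp only [cubicTwistFamily, Set.mem_ofPred_eq, Finset.coe_filter, hS, Finset.mem_filter,
      mem_monicPrimes]
    constructor
    · rintro ⟨h1, h2, h3, h4, h5⟩
      refine ⟨⟨h1, h2, fun Q hQ hQi hd => ⟨⟨hQ, hQi, ?_⟩, fun hQB => ?_⟩⟩, h4, h5⟩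
      · exact (natDegree_le_radDeg h1.ne_zero hQ hQi hd).trans h4.le
      · exact hQi.not_isUnit (h3.isUnit_of_dvd' hd hQB)
    · rintro ⟨⟨h1, h2, h3⟩, h4, h5⟩
      refine ⟨h1, h2, ?_, h4, h5⟩
      by_contra hc
      have hg : ¬ IsUnit (EuclideanDomain.gcd D B) := fun hu =>
        hc (EuclideanDomain.gcd_isUnit_iff.1 hu)
      obtain ⟨Q, hQ, hQi, hd⟩ := exists_monic_irreducible_factor _ hg
      exact (h3 Q hQ hQi (hd.trans (EuclideanDomain.gcd_dvd_left _ _))).2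
        (hd.trans (EuclideanDomain.gcd_dvd_right _ _))
  rw [hfam, finsum_mem_coe_finset, Finset.mul_sum, Finset.sum_filter]
  simp only [hprod, map_sum, PowerSeries.coeff_C_mul, PowerSeries.coeff_X_pow]
  rw [Finset.sum_comm]
  refine Finset.sum_congr rfl fun D _ => ?_
  simp only [degreeTwist_apply]
  rw [← Finset.sum_mul, ← Finset.mul_sum, sum_range_three_pow_eq hw]
  by_cases hN : D.radDeg = N
  · by_cases h3 : 3 ∣ D.natDegree
    · simp [hN, h3, mul_comm]
    · simp [h3]
  · simp [hN, Ne.symm hN]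
end

theorem norm_mulChar_le_one_of_pow_eq_one {R : Type*} [CommMonoid R] {ψ : MulChar R ℂ} {n : ℕ}
    (hn : n ≠ 0) (h : ψ ^ n = 1) (x : R) : ‖ψ x‖ ≤ 1 := by
  by_cases hx : IsUnit x
  · have h1 : ψ x ^ n = 1 := by
      rw [← MulChar.pow_apply' ψ hn, h, MulChar.one_apply hx]
    exact (Complex.norm_eq_one_of_pow_eq_one h1 hn).le
  · rw [MulChar.map_nonunit ψ hx]
    simp

/-- Proposition 4.3 of the paper (unnormalized form): for every `ε > 0` there is a constant
`C = C(q, B, ε)` such that for every monic irreducible `P`, every nontrivial cubic character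
`ψ` of `𝔽_q[T]/(P)`, and every `N ≥ 1`,
`|∑_{D ∈ F_N(B)} ψ(D mod P)| ≤ C · e^{2 deg P} · q^{(1/2+ε)N}`. -/
theorem cubic_character_sum_over_family_bound
    (Fq : Type*) [Field Fq] [Fintype Fq] [DecidableEq Fq]
    (h6 : Fintype.card Fq % 6 = 1) (B : Fq[X]) (hB : B ≠ 0) :
    ∀ ε : ℝ, 0 < ε → ∃ C : ℝ, ∀ P : Fq[X], P.Monic → Irreducible P →
      ∀ ψ : MulChar (Fq[X] ⧸ Ideal.span {P}) ℂ, ψ ^ 3 = 1 → ψ ≠ 1 →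
      ∀ N : ℕ, 1 ≤ N →
        ‖∑ᶠ D ∈ cubicTwistFamily B N, ψ (Ideal.Quotient.mk (Ideal.span {P}) D)‖ ≤
          C * Real.exp (2 * P.natDegree) *
            (Fintype.card Fq : ℝ) ^ ((1 / 2 + ε) * N) := by
  classical
  intro ε hε
  set q : ℝ := (Fintype.card Fq : ℝ)
  have hq1 : 1 < q := Nat.one_lt_cast.2 Fintype.one_lt_card
  have hq0 : 0 < q := by linarith
  set r : ℝ := q ^ (-(1 / 2 + ε)) with hr
  have hr0 : 0 < r := Real.rpow_pos_of_pos hq0 _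
  have hr1 : r ≤ 1 := Real.rpow_le_one_of_one_le_of_nonpos hq1.le (by linarith)
  have hqr : √q * r ≤ 1 := by
    rw [Real.sqrt_eq_rpow, hr, ← Real.rpow_add hq0]
    exact Real.rpow_le_one_of_one_le_of_nonpos hq1.le (by linarith)
  have hqr2 : q * r ^ 2 < 1 := by
    rw [hr, ← Real.rpow_natCast, ← Real.rpow_mul hq0.le]
    nth_rewrite 1 [← Real.rpow_one q]
    rw [← Real.rpow_add hq0]
    refine Real.rpow_lt_one_of_one_lt_of_neg hq1 ?_
    push_cast
    linarith
  refine ⟨4 ^ (normalizedFactors B).toFinset.card * Real.exp (7 * (1 - q * r ^ 2)⁻¹), ?_⟩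
  intro P hP hPi ψ hψ3 hψ1 N _
  set K := 4 ^ (normalizedFactors B).toFinset.card * Real.exp (7 * (1 - q * r ^ 2)⁻¹)
  have hK0 : 0 ≤ K := by positivity
  have hmax : (Ideal.span {P}).IsMaximal := PrincipalIdealRing.isMaximal_of_irreducible hPi
  have hnt : Nontrivial (Fq[X] ⧸ Ideal.span {P}) := Ideal.Quotient.nontrivial_iff.2 hmax.ne_top
  set χ : Fq[X] →* ℂ := ψ.toMonoidHom.comp (Ideal.Quotient.mk (Ideal.span {P}) : Fq[X] →* _)
  have hχ_apply : ∀ f, χ f = ψ (Ideal.Quotient.mk (Ideal.span {P}) f) := fun _ => rfl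
  have hχ0 : χ 0 = 0 := by
    rw [hχ_apply, map_zero]
    exact MulChar.map_zero ψ
  have hψ2 : ψ ^ 2 ≠ 1 := by
    intro h
    rw [pow_succ, h, one_mul] at hψ3
    exact hψ1 hψ3
  have hψ23 : (ψ ^ 2) ^ 3 = 1 := by rw [← pow_mul, mul_comm, pow_mul, hψ3, one_pow]
  have hRH1 : SatisfiesRH χ P.natDegree := satisfiesRH_of_mulChar h6 hP hPi hψ3 hψ1
  have hRH2 : SatisfiesRH (χ ^ 2) P.natDegree := by
    have : χ ^ 2 = (ψ ^ 2).toMonoidHom.comp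
        (Ideal.Quotient.mk (Ideal.span {P}) : Fq[X] →* _) := by
      ext f
      exact (MulChar.pow_apply' ψ two_ne_zero _).symm
    rw [this]
    exact satisfiesRH_of_mulChar h6 hP hPi hψ23 hψ2
  have hw := Complex.isPrimitiveRoot_exp 3 (by norm_num)
  set w := Complex.exp (2 * Real.pi * Complex.I / (3 : ℕ))
  have hbound : ∀ j, ‖PowerSeries.coeff N
      (∏ Q ∈ (monicPrimes Fq N).filter fun Q => ¬ Q ∣ B,
        (1 + PowerSeries.C (degreeTwist χ hχ0 (w ^ j) Q + degreeTwist χ hχ0 (w ^ j) Q ^ 2) *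
          PowerSeries.X ^ Q.natDegree))‖ * r ^ N ≤ K * Real.exp (2 * P.natDegree) := by
    intro j
    have hζ : ‖w ^ j‖ = 1 := by
      rw [norm_pow, hw.norm'_eq_one (by norm_num), one_pow]
    have hχ20 : (χ ^ 2) 0 = 0 := by rw [MonoidHom.pow_apply, hχ0, zero_pow two_ne_zero]
    have h2 : degreeTwist χ hχ0 (w ^ j) ^ 2 = degreeTwist (χ ^ 2) hχ20 ((w ^ j) ^ 2) := by
      ext f
      rw [MonoidHom.pow_apply, degreeTwist_apply, degreeTwist_apply, MonoidHom.pow_apply]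
      ring
    refine (norm_coeff_cubic_euler_product_le hB (hRH1.degreeTwist hχ0 hζ) ?_ ?_ hr0.le hr1 hqr
      hqr2).trans (mul_le_mul_of_nonneg_left ?_ hK0)
    · rw [h2]
      exact hRH2.degreeTwist hχ20 (by rw [norm_pow, hζ, one_pow])
    · intro f
      rw [degreeTwist_apply, norm_mul, norm_pow, hζ, one_pow, mul_one, hχ_apply]
      exact norm_mulChar_le_one_of_pow_eq_one three_ne_zero hψ3 _
    · rw [mul_comm, Real.exp_nat_mul]
      refine pow_le_pow_left₀ (by norm_num) ?_ _
      have := Real.add_one_le_exp (1 : ℝ)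
      have h3 : Real.exp 2 = Real.exp 1 * Real.exp 1 := by
        rw [← Real.exp_add]
        norm_num
      nlinarith
  have hrN : r ^ N * q ^ ((1 / 2 + ε) * N) = 1 := by
    rw [hr, ← Real.rpow_natCast, ← Real.rpow_mul hq0.le, ← Real.rpow_add hq0,
      show -(1 / 2 + ε) * (N : ℝ) + (1 / 2 + ε) * N = 0 by ring, Real.rpow_zero]
  have hsum := finsum_mem_cubicTwistFamily_eq (B := B) hχ0 hw N
  have hnorm : 3 * ‖∑ᶠ D ∈ cubicTwistFamily B N, χ D‖ * r ^ N ≤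
      3 * (K * Real.exp (2 * P.natDegree)) := by
    have h3 : (3 : ℝ) = ‖(3 : ℂ)‖ := by simp
    nth_rewrite 1 [h3]
    rw [← norm_mul, hsum]
    refine (mul_le_mul_of_nonneg_right (norm_sum_le _ _) (by positivity)).trans ?_
    rw [Finset.sum_mul]
    refine (Finset.sum_le_card_nsmul _ _ _ fun j _ => hbound j).trans_eq ?_
    simp
  have hpos : 0 < q ^ ((1 / 2 + ε) * N) := Real.rpow_pos_of_pos hq0 _
  calc ‖∑ᶠ D ∈ cubicTwistFamily B N, χ D‖
      = ‖∑ᶠ D ∈ cubicTwistFamily B N, χ D‖ * r ^ N * q ^ ((1 / 2 + ε) * N) := by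
        rw [mul_assoc, hrN, mul_one]
    _ ≤ _ := by
        refine mul_le_mul_of_nonneg_right ?_ hpos.le
        linarith
end
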